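/- arXiv:1511.08948 — 3 statements merged into one kernel-verified Lean document; each statement's English description precedes it below -/
import Mathlib

section
/- Let φ : A → B be a q-equivalence of CDGAs over k, let P be a finite-dimensional graded k-vector space concentrated in odd degrees with homogeneous basis t_1,…,t_r of degrees m_1,…,m_r, set m = max_α m_α, and let τ : P → Z^{•+1}(A) be a degree-one linear map. If q ≥ m + 1, then the induced CDGA morphism φ ⊗ id : A ⊗_τ ΛP → B ⊗_{φ∘τ} ΛP is a q-equivalence. -/
noncomputable section
set_option synthInstance.maxHeartbeats 1000000
set_option maxHeartbeats 1600000
set_option linter.unusedVariables false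

open scoped TensorProduct

universe u v

/-- A commutative differential graded algebra (CDGA) over a field `k`:
a non-negatively graded `k`-vector space with an associative unital multiplication
satisfying graded commutativity, together with a degree-one differential satisfying
`d ∘ d = 0` and the graded Leibniz rule. -/
structure CDGA (k : Type u) [Field k] where
  carrier : Type v
  [ring : Ring carrier]
  [algebra : Algebra k carrier]
  grading : ℕ → Submodule k carrier
  decomp : DirectSum.Decomposition grading
  one_mem : (1 : carrier) ∈ grading 0
  mul_mem : ∀ {i j : ℕ} {a b : carrier}, a ∈ grading i → b ∈ grading j →
      a * b ∈ grading (i + j)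
  gcomm : ∀ {i j : ℕ} {a b : carrier}, a ∈ grading i → b ∈ grading j →
      a * b = (-1 : k) ^ (i * j) • (b * a)
  d : carrier →ₗ[k] carrier
  d_mem : ∀ {i : ℕ} {a : carrier}, a ∈ grading i → d a ∈ grading (i + 1)
  d_d : ∀ a : carrier, d (d a) = 0
  leibniz : ∀ {i : ℕ} {a : carrier}, a ∈ grading i → ∀ b : carrier,
      d (a * b) = d a * b + (-1 : k) ^ i • (a * d b)

attribute [instance] CDGA.ring CDGA.algebra

namespace CDGA

variable {k : Type u} [Field k]

/-- The `d`-cocycles of degree `i`. -/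
def Zc (A : CDGA k) (i : ℕ) : Submodule k A.carrier :=
  A.grading i ⊓ LinearMap.ker A.d

/-- The `d`-coboundaries of degree `i`. -/
def Bc (A : CDGA k) : ℕ → Submodule k A.carrier
  | 0 => ⊥
  | (i + 1) => (A.grading i).map A.d

/-- A CDGA is connected if its degree-zero part is `k·1`. -/
def Connected (A : CDGA k) : Prop :=
  A.grading 0 = Submodule.span k {(1 : A.carrier)}

end CDGA

/-- A morphism of CDGAs: an algebra map preserving the grading and commuting with
the differentials. -/
structure CDGAHom {k : Type u} [Field k] (A B : CDGA k) where
  toFun : A.carrier →ₐ[k] B.carrier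
  map_grading : ∀ {i : ℕ} {a : A.carrier}, a ∈ A.grading i → toFun a ∈ B.grading i
  map_d : ∀ a : A.carrier, toFun (A.d a) = B.d (toFun a)

/-- `φ : A → B` is a `q`-equivalence if the induced map `H^i(A) → H^i(B)` is an
isomorphism for `i ≤ q` and injective for `i = q + 1`. -/
def CDGAHom.IsQEquiv {k : Type u} [Field k] {A B : CDGA k} (φ : CDGAHom A B) (q : ℕ) : Prop :=
  (∀ i ≤ q, ∀ b ∈ B.Zc i, ∃ a ∈ A.Zc i, φ.toFun a - b ∈ B.Bc i) ∧
  (∀ i ≤ q + 1, ∀ a ∈ A.Zc i, φ.toFun a ∈ B.Bc i → a ∈ A.Bc i)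

/-- The ordered square-free monomial in the generators `t` indexed by `S`. -/
def tmono {k : Type u} [Field k] (A : CDGA k) {r : ℕ} (t : Fin r → A.carrier)
    (S : Finset (Fin r)) : A.carrier :=
  ((S.sort (· ≤ ·)).map t).prod

/-- `A` is the Hirsch extension `B ⊗_τ ΛP`, where `P` has homogeneous basis
`t_1, …, t_r` of odd degrees `m_1, …, m_r`, with `d t_i = τ(t_i) = e_i`. -/
structure IsHirsch {k : Type u} [Field k] (B A : CDGA k) (φ : CDGAHom B A)
    {r : ℕ} (m : Fin r → ℕ) (t : Fin r → A.carrier) (e : Fin r → B.carrier) : Prop where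
  odd_deg : ∀ i, Odd (m i)
  t_mem : ∀ i, t i ∈ A.grading (m i)
  e_cocycle : ∀ i, e i ∈ B.Zc (m i + 1)
  dt : ∀ i, A.d (t i) = φ.toFun (e i)
  inj : Function.Injective φ.toFun
  free : ∀ a : A.carrier, ∃! c : Finset (Fin r) → B.carrier,
      a = ∑ S : Finset (Fin r), φ.toFun (c S) * tmono A t S
  mono_mem : ∀ (S : Finset (Fin r)) {j : ℕ} {b : B.carrier}, b ∈ B.grading j →
      φ.toFun b * tmono A t S ∈ A.grading (j + ∑ i ∈ S, m i)

namespace CDGA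

variable {k : Type u} [Field k]

/-- The grading of a CDGA extended by zero to all integer degrees. -/
def gr (A : CDGA k) (n : ℤ) : Submodule k A.carrier :=
  if 0 ≤ n then A.grading n.toNat else ⊥

@[simp]
lemma gr_natCast (A : CDGA k) (n : ℕ) : A.gr n = A.grading n := by
  simp [gr]

lemma gr_of_neg (A : CDGA k) {n : ℤ} (hn : n < 0) : A.gr n = ⊥ := by
  simp [gr, hn]

lemma eq_zero_or_mem_grading {A : CDGA k} {n : ℤ} {a : A.carrier} (ha : a ∈ A.gr n) :
    a = 0 ∨ ∃ i : ℕ, n = i ∧ a ∈ A.grading i := by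
  rcases lt_or_ge n 0 with hn | hn
  · left
    simpa [gr_of_neg A hn] using ha
  · right
    lift n to ℕ using hn
    exact ⟨n, rfl, by simpa using ha⟩

lemma d_mem_gr {A : CDGA k} {n : ℤ} {a : A.carrier} (ha : a ∈ A.gr n) :
    A.d a ∈ A.gr (n + 1) := by
  rcases eq_zero_or_mem_grading ha with rfl | ⟨i, rfl, hi⟩
  · simp
  · exact_mod_cast (gr_natCast A (i + 1)).symm ▸ A.d_mem hi

lemma mul_mem_gr {A : CDGA k} {i j : ℤ} {a b : A.carrier} (ha : a ∈ A.gr i) (hb : b ∈ A.gr j) :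
    a * b ∈ A.gr (i + j) := by
  rcases eq_zero_or_mem_grading ha with rfl | ⟨i, rfl, hi⟩
  · simp
  rcases eq_zero_or_mem_grading hb with rfl | ⟨j, rfl, hj⟩
  · simp
  · exact_mod_cast (gr_natCast A (i + j)).symm ▸ A.mul_mem hi hj

lemma leibniz_gr {A : CDGA k} {n : ℤ} {a : A.carrier} (ha : a ∈ A.gr n) (b : A.carrier) :
    A.d (a * b) = A.d a * b + (-1 : k) ^ n • (a * A.d b) := by
  rcases eq_zero_or_mem_grading ha with rfl | ⟨i, rfl, hi⟩
  · simp
  · simpa using A.leibniz hi b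

/-- Homogeneous elements of even degree are central. -/
lemma commute_of_even {A : CDGA k} {i : ℕ} (hi : Even i) {a : A.carrier} (ha : a ∈ A.grading i)
    {j : ℕ} {b : A.carrier} (hb : b ∈ A.grading j) : a * b = b * a := by
  simpa [(hi.mul_right j).neg_one_pow] using A.gcomm ha hb

lemma mem_Bc_iff {A : CDGA k} {n : ℕ} {a : A.carrier} :
    a ∈ A.Bc n ↔ ∃ x ∈ A.gr ((n : ℤ) - 1), a = A.d x := by
  cases n with
  | zero => simp [Bc, gr_of_neg]
  | succ n => simp [Bc, eq_comm]

end CDGA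

section Families

variable {k : Type u} [Field k] {A B A' B' : CDGA k}

lemma CDGAHom.map_gr (φ : CDGAHom A B) {n : ℤ} {a : A.carrier} (ha : a ∈ A.gr n) :
    φ.toFun a ∈ B.gr n := by
  rcases CDGA.eq_zero_or_mem_grading ha with rfl | ⟨i, rfl, hi⟩
  · simp
  · simpa using φ.map_grading hi

/-- The `q`-equivalence condition for the restriction of `Φ` to graded families of
subspaces `F` and `G`. -/
def CDGAHom.IsQEquivOn (Φ : CDGAHom A B) (F : ℤ → Submodule k A.carrier)
    (G : ℤ → Submodule k B.carrier) (q : ℤ) : Prop :=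
  (∀ n ≤ q, ∀ b ∈ G n, B.d b = 0 →
    ∃ a ∈ F n, A.d a = 0 ∧ ∃ w ∈ G (n - 1), Φ.toFun a - b = B.d w) ∧
  (∀ n ≤ q + 1, ∀ a ∈ F n, A.d a = 0 → ∀ w ∈ G (n - 1), Φ.toFun a = B.d w →
    ∃ x ∈ F (n - 1), a = A.d x)

lemma CDGAHom.isQEquiv_iff_isQEquivOn_gr (Φ : CDGAHom A B) (q : ℕ) :
    Φ.IsQEquiv q ↔ Φ.IsQEquivOn A.gr B.gr q := by
  constructor
  · rintro ⟨hs, hi⟩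
    refine ⟨fun n hn b hb hdb => ?_, fun n hn a ha hda w hw haw => ?_⟩
    · rcases CDGA.eq_zero_or_mem_grading hb with rfl | ⟨i, rfl, hb⟩
      · exact ⟨0, by simp, by simp, 0, by simp, by simp⟩
      · obtain ⟨a, ⟨ha, hda⟩, hab⟩ := hs i (by exact_mod_cast hn) b ⟨hb, hdb⟩
        exact ⟨a, by simpa using ha, hda, CDGA.mem_Bc_iff.1 hab⟩
    · rcases CDGA.eq_zero_or_mem_grading ha with rfl | ⟨i, rfl, ha⟩
      · exact ⟨0, by simp, by simp⟩
      · exact CDGA.mem_Bc_iff.1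
          (hi i (by exact_mod_cast hn) a ⟨ha, hda⟩ (CDGA.mem_Bc_iff.2 ⟨w, hw, haw⟩))
  · rintro ⟨hs, hi⟩
    refine ⟨fun n hn b hb => ?_, fun n hn a ha hab => ?_⟩
    · obtain ⟨a, ha, hda, hab⟩ := hs n (by exact_mod_cast hn) b (by simpa using hb.1) hb.2
      exact ⟨a, ⟨by simpa using ha, hda⟩, CDGA.mem_Bc_iff.2 hab⟩
    · obtain ⟨w, hw, haw⟩ := CDGA.mem_Bc_iff.1 hab
      exact CDGA.mem_Bc_iff.2
        (hi n (by exact_mod_cast hn) a (by simpa using ha.1) ha.2 w hw haw)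

/-- `F'` is obtained from the subcomplex `F` by freely adjoining right multiples of an element
`t` of degree `m` with `d t = e`. -/
structure IsAdjoin (A : CDGA k) (F F' : ℤ → Submodule k A.carrier) (m : ℕ) (t e : A.carrier) :
    Prop where
  le_gr : ∀ {n x}, x ∈ F n → x ∈ A.gr n
  d_mem : ∀ {n x}, x ∈ F n → A.d x ∈ F (n + 1)
  mul_mem : ∀ {n x}, x ∈ F n → x * e ∈ F (n + m + 1)
  d_t : A.d t = e
  mem_iff : ∀ {n a}, a ∈ F' n ↔ ∃ x ∈ F n, ∃ y ∈ F (n - m), a = x + y * t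
  indep : ∀ {i j x y}, x ∈ F i → y ∈ F j → x + y * t = 0 → x = 0 ∧ y = 0

namespace IsAdjoin

variable {F F' : ℤ → Submodule k A.carrier} {m : ℕ} {t e : A.carrier}

lemma d_e (h : IsAdjoin A F F' m t e) : A.d e = 0 := by
  rw [← h.d_t, A.d_d]

lemma d_mul_e (h : IsAdjoin A F F' m t e) {n : ℤ} {x : A.carrier} (hx : x ∈ F n) :
    A.d (x * e) = A.d x * e := by
  simp [CDGA.leibniz_gr (h.le_gr hx), h.d_e]

lemma d_mul_t (h : IsAdjoin A F F' m t e) {n : ℤ} {x : A.carrier} (hx : x ∈ F n) :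
    A.d (x * t) = A.d x * t + (-1 : k) ^ n • (x * e) := by
  rw [CDGA.leibniz_gr (h.le_gr hx), h.d_t]

lemma d_add (h : IsAdjoin A F F' m t e) {j : ℤ} (x : A.carrier) {y : A.carrier}
    (hy : y ∈ F j) :
    A.d (x + y * t) = (A.d x + (-1 : k) ^ j • (y * e)) + A.d y * t := by
  rw [map_add, h.d_mul_t hy]; abel

lemma mul_mem_of_eq (h : IsAdjoin A F F' m t e) {n l : ℤ} {x : A.carrier} (hx : x ∈ F n)
    (hl : n + m + 1 = l) : x * e ∈ F l :=
  hl ▸ h.mul_mem hx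

lemma d_mem_of_eq (h : IsAdjoin A F F' m t e) {n l : ℤ} {x : A.carrier} (hx : x ∈ F n)
    (hl : n + 1 = l) : A.d x ∈ F l :=
  hl ▸ h.d_mem hx

lemma d_mem_adjoin (h : IsAdjoin A F F' m t e) {n : ℤ} {a : A.carrier} (ha : a ∈ F' n) :
    A.d a ∈ F' (n + 1) := by
  obtain ⟨x, hx, y, hy, rfl⟩ := h.mem_iff.1 ha
  refine h.mem_iff.2 ⟨_, add_mem (h.d_mem hx) (Submodule.smul_mem _ _ (h.mul_mem_of_eq hy ?_)),
    _, h.d_mem_of_eq hy ?_, h.d_add x hy⟩ <;> ring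

/-- The components of an equality in a free adjunction agree. -/
lemma add_inj (h : IsAdjoin A F F' m t e) {i j : ℤ} {x x' y y' : A.carrier}
    (hx : x ∈ F i) (hx' : x' ∈ F i) (hy : y ∈ F j) (hy' : y' ∈ F j)
    (heq : x + y * t = x' + y' * t) : x = x' ∧ y = y' := by
  have := h.indep (sub_mem hx hx') (sub_mem hy hy')
    (by rw [sub_mul, ← sub_eq_zero.2 heq]; abel)
  exact ⟨sub_eq_zero.1 this.1, sub_eq_zero.1 this.2⟩

/-- The components of a cocycle in a free adjunction. -/
lemma cocycle (h : IsAdjoin A F F' m t e) {n : ℤ} {x y : A.carrier}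
    (hx : x ∈ F n) (hy : y ∈ F (n - m)) (hd : A.d (x + y * t) = 0) :
    A.d x + (-1 : k) ^ (n - m) • (y * e) = 0 ∧ A.d y = 0 := by
  refine h.indep (add_mem (h.d_mem hx) (Submodule.smul_mem _ _ (h.mul_mem_of_eq hy ?_)))
    (h.d_mem hy) (by rw [← h.d_add x hy, hd])
  ring

end IsAdjoin

/-- Freely adjoining an element to both sides preserves `q`-equivalences. -/
lemma CDGAHom.IsQEquivOn.adjoin {Φ : CDGAHom A B} {F F' : ℤ → Submodule k A.carrier}
    {G G' : ℤ → Submodule k B.carrier} {m : ℕ} {t e : A.carrier} {s f : B.carrier} {q : ℤ}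
    (hΦ : Φ.IsQEquivOn F G q) (hF : IsAdjoin A F F' m t e) (hG : IsAdjoin B G G' m s f)
    (hFG : ∀ {n x}, x ∈ F n → Φ.toFun x ∈ G n) (ht : Φ.toFun t = s) :
    Φ.IsQEquivOn F' G' q := by
  have he : Φ.toFun e = f := by rw [← hF.d_t, Φ.map_d, ht, hG.d_t]
  have hsign : ∀ l : ℤ, (-1 : k) ^ (l - 1) = -(-1 : k) ^ l := fun l => by
    rw [zpow_sub_one₀ (by simp)]; simp
  obtain ⟨hs, hi⟩ := hΦ
  constructor
  · intro n hn b hb hdb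
    obtain ⟨u, hu, v, hv, rfl⟩ := hG.mem_iff.1 hb
    obtain ⟨hduv, hdv⟩ := hG.cocycle hu hv hdb
    obtain ⟨y, hy, hdy, w, hw, hyw⟩ := hs (n - m) (by omega) v hv hdv
    have hwf : w * f ∈ G n := hG.mul_mem_of_eq hw (by ring)
    set ε : k := (-1 : k) ^ (n - m) with hε
    have hεε : ε * ε = 1 := by rw [hε, ← mul_zpow]; simp
    have hv' : v = Φ.toFun y - B.d w := by rw [← hyw]; abel
    have hyef : Φ.toFun (y * e) = B.d (w * f - ε • u) := by
      have hvf : v * f = -(ε • B.d u) := by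
        have := congrArg (fun z => ε • z) hduv
        simp only [smul_add, smul_smul, hεε, one_smul, smul_zero] at this
        exact (neg_eq_of_add_eq_zero_right this).symm
      rw [map_mul, he, map_sub, map_smul, hG.d_mul_e hw, sub_eq_add_neg, ← hvf, hv', sub_mul]
      abel
    obtain ⟨x₀, hx₀, hyx₀⟩ := hi (n + 1) (by omega) (y * e)
      (hF.mul_mem_of_eq hy (by ring)) (by rw [hF.d_mul_e hy, hdy, zero_mul]) (w * f - ε • u)
      (by simpa using sub_mem hwf (Submodule.smul_mem _ _ hu)) hyef
    replace hx₀ : x₀ ∈ F n := by simpa using hx₀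
    obtain ⟨x₁, hx₁, hdx₁, w₁, hw₁, hxw₁⟩ := hs n hn (u + ε • Φ.toFun x₀ - ε • (w * f))
      (sub_mem (add_mem hu (Submodule.smul_mem _ _ (hFG hx₀))) (Submodule.smul_mem _ _ hwf))
      (by
        rw [map_sub, map_add, map_smul, map_smul, ← Φ.map_d, ← hyx₀, hyef, map_sub, map_smul,
          smul_sub, smul_smul, hεε, one_smul]
        abel)
    refine ⟨(x₁ - ε • x₀) + y * t,
      hF.mem_iff.2 ⟨_, sub_mem hx₁ (Submodule.smul_mem _ _ hx₀), y, hy, rfl⟩, ?_,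
      w₁ + w * s, hG.mem_iff.2 ⟨w₁, hw₁, w, by convert hw using 2; ring, rfl⟩, ?_⟩
    · rw [hF.d_add _ hy, hdy, map_sub, map_smul, hdx₁, ← hyx₀]
      simp [hε]
    · rw [hG.d_add _ hw, hsign, ← hxw₁, ← hyw]
      simp only [map_add, map_sub, map_mul, map_smul, ht, sub_mul, neg_smul]
      abel
  · intro n hn a ha hda b hb hab
    obtain ⟨x, hx, y, hy, rfl⟩ := hF.mem_iff.1 ha
    obtain ⟨u, hu, v, hv, rfl⟩ := hG.mem_iff.1 hb
    obtain ⟨hdxy, hdy⟩ := hF.cocycle hx hy hda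
    replace hv : v ∈ G (n - m - 1) := by convert hv using 2; ring
    set ε : k := (-1 : k) ^ (n - m) with hε
    have hvf : v * f ∈ G n := hG.mul_mem_of_eq hv (by ring)
    rw [hG.d_add _ hv, hsign, map_add, map_mul, ht] at hab
    obtain ⟨hΦx, hΦy⟩ := hG.add_inj (hFG hx)
      (add_mem (hG.d_mem_of_eq hu (by ring)) (Submodule.smul_mem _ _ hvf)) (hFG hy)
      (hG.d_mem_of_eq hv (by ring)) hab
    obtain ⟨y₀, hy₀, rfl⟩ := hi (n - m) (by omega) y hy hdy v hv hΦy
    obtain ⟨y₁, hy₁, hdy₁, w, hw, hyw⟩ := hs (n - m - 1) (by omega) (Φ.toFun y₀ - v)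
      (sub_mem (hFG hy₀) hv) (by rw [map_sub, ← Φ.map_d, hΦy, sub_self])
    have hy₂ : y₀ - y₁ ∈ F (n - m - 1) := sub_mem hy₀ hy₁
    have hΦy₂ : Φ.toFun (y₀ - y₁) = v - B.d w := by rw [map_sub, ← hyw]; abel
    have hdy₂ : A.d (y₀ - y₁) = A.d y₀ := by rw [map_sub, hdy₁, sub_zero]
    obtain ⟨x₀, hx₀, hxx₀⟩ := hi n hn (x + ε • ((y₀ - y₁) * e))
      (add_mem hx (Submodule.smul_mem _ _ (hF.mul_mem_of_eq hy₂ (by ring))))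
      (by rw [map_add, map_smul, hF.d_mul_e hy₂, hdy₂, hdxy])
      (u - ε • (w * f))
      (sub_mem hu (Submodule.smul_mem _ _ (hG.mul_mem_of_eq hw (by ring))))
      (by
        rw [map_add, map_smul, map_mul, hΦx, hΦy₂, he, map_sub, map_smul, hG.d_mul_e hw]
        simp only [sub_mul, smul_sub, neg_smul]
        abel)
    refine ⟨x₀ + (y₀ - y₁) * t,
      hF.mem_iff.2 ⟨x₀, hx₀, _, by convert hy₂ using 2; ring, rfl⟩, ?_⟩
    rw [hF.d_add _ hy₂, hsign, hdy₂, ← hxx₀, neg_smul]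
    abel

end Families

section Monomials

variable {k : Type u} [Field k] {A B A' B' : CDGA k} {r : ℕ}

@[simp]
lemma tmono_empty (t : Fin r → A.carrier) : tmono A t ∅ = 1 := by
  simp [tmono]

/-- Adjoining a new largest index multiplies the monomial on the right. -/
lemma tmono_insert_of_lt (t : Fin r → A.carrier) {S : Finset (Fin r)} {p : Fin r}
    (hS : ∀ i ∈ S, i < p) : tmono A t (insert p S) = tmono A t S * t p := by
  have hsort : (insert p S).sort (· ≤ ·) = S.sort (· ≤ ·) ++ [p] := by
    refine List.Perm.eq_of_pairwise' (r := (· ≤ ·)) (Finset.pairwise_sort _ _) ?_ ?_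
    · refine List.pairwise_append.2 ⟨Finset.pairwise_sort _ _, by simp, ?_⟩
      simpa using fun i hi => (hS i hi).le
    · refine (List.perm_ext_iff_of_nodup (Finset.sort_nodup _ _) ?_).2 fun i => ?_
      · exact List.nodup_append.2 ⟨Finset.sort_nodup _ _, by simp, by
          simpa using fun i hi => (hS i hi).ne⟩
      · simp [or_comm]
  simp [tmono, hsort]

/-- The element with coefficients `c` in the monomials `tmono A' t S`. -/
def monoSum (ι : CDGAHom A A') (t : Fin r → A'.carrier) :
    (Finset (Fin r) → A.carrier) →ₗ[k] A'.carrier where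
  toFun c := ∑ S, ι.toFun (c S) * tmono A' t S
  map_add' c c' := by simp [add_mul, Finset.sum_add_distrib]
  map_smul' x c := by simp [Finset.smul_sum]

lemma monoSum_apply (ι : CDGAHom A A') (t : Fin r → A'.carrier)
    (c : Finset (Fin r) → A.carrier) :
    monoSum ι t c = ∑ S, ι.toFun (c S) * tmono A' t S := rfl

lemma CDGAHom.map_tmono (Φ : CDGAHom A B) (t : Fin r → A.carrier) (S : Finset (Fin r)) :
    Φ.toFun (tmono A t S) = tmono B (fun i => Φ.toFun (t i)) S := by
  simp [tmono, map_list_prod, Function.comp_def]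

/-- The degree `n` coefficient families supported on sets of indices less than `p`. -/
def coeffs (A : CDGA k) (m : Fin r → ℕ) (p : ℕ) (n : ℤ) :
    Submodule k (Finset (Fin r) → A.carrier) where
  carrier := {c | ∀ S, c S ∈ A.gr (n - ∑ i ∈ S, (m i : ℤ)) ∧ ((∃ i ∈ S, p ≤ i.val) → c S = 0)}
  add_mem' hc hc' S := ⟨add_mem (hc S).1 (hc' S).1, fun h => by
    rw [Pi.add_apply, (hc S).2 h, (hc' S).2 h, add_zero]⟩
  zero_mem' S := ⟨zero_mem _, fun _ => rfl⟩
  smul_mem' x c hc S := ⟨Submodule.smul_mem _ _ (hc S).1, fun h => by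
    rw [Pi.smul_apply, (hc S).2 h, smul_zero]⟩

/-- The degree `n` part of the subcomplex generated by the first `p` generators. -/
def stage (ι : CDGAHom A A') (m : Fin r → ℕ) (t : Fin r → A'.carrier) (p : ℕ) (n : ℤ) :
    Submodule k A'.carrier :=
  (coeffs A m p n).map (monoSum ι t)

/-- The coefficients of `monoSum ι t c + monoSum ι t c' * t p`. -/
def combine (p : Fin r) (c c' : Finset (Fin r) → A.carrier) (S : Finset (Fin r)) : A.carrier :=
  if p ∈ S then c' (S.erase p) else c S

lemma monoSum_combine (ι : CDGAHom A A') (m : Fin r → ℕ) (t : Fin r → A'.carrier) (p : Fin r)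
    {c c' : Finset (Fin r) → A.carrier} {i j : ℤ} (hc : c ∈ coeffs A m p i)
    (hc' : c' ∈ coeffs A m p j) :
    monoSum ι t (combine p c c') = monoSum ι t c + monoSum ι t c' * t p := by
  classical
  have hsplit : ∀ g : Finset (Fin r) → A'.carrier,
      ∑ S, g S = ∑ S with p ∉ S, (g S + g (insert p S)) := fun g => by
    rw [← Finset.sum_filter_add_sum_filter_not _ (fun S => p ∉ S) g, Finset.sum_add_distrib]
    congr 1
    refine Finset.sum_nbij' (fun S => S.erase p) (fun S => insert p S) ?_ ?_ ?_ ?_ ?_ <;>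
      simp +contextual
  simp only [monoSum_apply, Finset.sum_mul]
  rw [hsplit, hsplit, hsplit, ← Finset.sum_add_distrib]
  refine Finset.sum_congr rfl fun S hS => ?_
  have hpS : p ∉ S := by simpa using hS
  have hz := (hc (insert p S)).2 ⟨p, by simp, le_rfl⟩
  have hz' := (hc' (insert p S)).2 ⟨p, by simp, le_rfl⟩
  simp only [combine, hpS, hz, hz', if_false, Finset.mem_insert_self, if_true,
    Finset.erase_insert hpS, map_zero, zero_mul, add_zero, add_right_inj]
  by_cases h : ∃ i ∈ S, p.val ≤ i.val
  · simp [(hc' S).2 h]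
  · push Not at h
    rw [tmono_insert_of_lt t h, mul_assoc]

end Monomials

namespace IsHirsch

variable {k : Type u} [Field k] {A A' : CDGA k} {ι : CDGAHom A A'} {r : ℕ} {m : Fin r → ℕ}
  {t : Fin r → A'.carrier} {e : Fin r → A.carrier}

lemma monoSum_bijective (h : IsHirsch A A' ι m t e) : Function.Bijective (monoSum ι t) := by
  refine ⟨fun c c' hcc' => ?_, fun a => ?_⟩
  · exact (h.free (monoSum ι t c)).unique rfl hcc'
  · obtain ⟨c, hc, -⟩ := h.free a
    exact ⟨c, hc.symm⟩

lemma mul_tmono_mem_gr (h : IsHirsch A A' ι m t e) (S : Finset (Fin r)) {n : ℤ} {a : A.carrier}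
    (ha : a ∈ A.gr (n - ∑ i ∈ S, (m i : ℤ))) : ι.toFun a * tmono A' t S ∈ A'.gr n := by
  rcases CDGA.eq_zero_or_mem_grading ha with rfl | ⟨j, hj, haj⟩
  · simp
  · obtain rfl : n = ((j + ∑ i ∈ S, m i : ℕ) : ℤ) := by push_cast; omega
    rw [CDGA.gr_natCast]
    exact h.mono_mem S haj

lemma stage_le_gr (h : IsHirsch A A' ι m t e) {p : ℕ} {n : ℤ} {x : A'.carrier}
    (hx : x ∈ stage ι m t p n) : x ∈ A'.gr n := by
  obtain ⟨c, hc, rfl⟩ := hx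
  rw [monoSum_apply]
  exact sum_mem fun S _ => h.mul_tmono_mem_gr S (hc S).1

lemma mul_mem_stage (h : IsHirsch A A' ι m t e) (j : Fin r) {p : ℕ} {n : ℤ} {x : A'.carrier}
    (hx : x ∈ stage ι m t p n) : x * ι.toFun (e j) ∈ stage ι m t p (n + m j + 1) := by
  obtain ⟨c, hc, rfl⟩ := hx
  have he : e j ∈ A.gr (m j + 1 : ℕ) := by
    rw [CDGA.gr_natCast]; exact (h.e_cocycle j).1
  refine ⟨fun S => c S * e j, fun S => ⟨?_, fun hS => by simp [(hc S).2 hS]⟩, ?_⟩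
  · convert CDGA.mul_mem_gr (hc S).1 he using 2
    push_cast; ring
  · simp only [monoSum_apply, Finset.sum_mul]
    refine Finset.sum_congr rfl fun S _ => ?_
    have ht : tmono A' t S ∈ A'.grading (0 + ∑ i ∈ S, m i) := by
      simpa using h.mono_mem S A.one_mem
    rw [map_mul, mul_assoc, mul_assoc, CDGA.commute_of_even (h.odd_deg j).add_one
      (ι.map_grading (h.e_cocycle j).1) ht]

lemma mem_stage_zero (h : IsHirsch A A' ι m t e) {n : ℤ} {x : A'.carrier} :
    x ∈ stage ι m t 0 n ↔ ∃ a ∈ A.gr n, ι.toFun a = x := by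
  classical
  constructor
  · rintro ⟨c, hc, rfl⟩
    refine ⟨c ∅, by simpa using (hc ∅).1, ?_⟩
    rw [monoSum_apply, Finset.sum_eq_single ∅]
    · simp
    · intro S _ hS
      obtain ⟨i, hi⟩ := Finset.nonempty_iff_ne_empty.2 hS
      simp [(hc S).2 ⟨i, hi, Nat.zero_le _⟩]
    · simp
  · rintro ⟨a, ha, rfl⟩
    refine ⟨fun S => if S = ∅ then a else 0, fun S => ?_, ?_⟩
    · by_cases hS : S = ∅
      · simp [hS, ha]
      · simp [hS]
    · rw [monoSum_apply, Finset.sum_eq_single ∅] <;> simp +contextual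

lemma mem_stage_succ (h : IsHirsch A A' ι m t e) (p : Fin r) {n : ℤ} {a : A'.carrier} :
    a ∈ stage ι m t (p + 1) n ↔
      ∃ x ∈ stage ι m t p n, ∃ y ∈ stage ι m t p (n - m p), a = x + y * t p := by
  classical
  constructor
  · rintro ⟨c, hc, rfl⟩
    have hx : (fun S => if p ∈ S then 0 else c S) ∈ coeffs A m p n := fun S => by
      by_cases hp : p ∈ S
      · simp [hp]
      · simp only [hp, if_false]
        refine ⟨(hc S).1, fun ⟨i, hi, hpi⟩ => (hc S).2 ⟨i, hi, ?_⟩⟩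
        have : p ≠ i := fun hpi => hp (hpi ▸ hi)
        have := Fin.val_ne_of_ne this
        omega
    have hy : (fun S => if p ∈ S then 0 else c (insert p S)) ∈ coeffs A m p (n - m p) :=
      fun S => by
      by_cases hp : p ∈ S
      · simp [hp]
      · simp only [hp, if_false]
        refine ⟨?_, fun ⟨i, hi, hpi⟩ => (hc _).2 ⟨i, by simp [hi], ?_⟩⟩
        · convert (hc (insert p S)).1 using 2
          rw [Finset.sum_insert hp]; ring
        · have : p ≠ i := fun hpi => hp (hpi ▸ hi)
          have := Fin.val_ne_of_ne this
          omega
    refine ⟨_, ⟨_, hx, rfl⟩, _, ⟨_, hy, rfl⟩, ?_⟩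
    rw [← monoSum_combine ι m t p hx hy]
    congr 1
    funext S
    by_cases hp : p ∈ S <;> simp [combine, hp]
  · rintro ⟨_, ⟨c, hc, rfl⟩, _, ⟨c', hc', rfl⟩, rfl⟩
    refine ⟨_, fun S => ?_, monoSum_combine ι m t p hc hc'⟩
    by_cases hp : p ∈ S
    · simp only [combine, hp, if_true]
      refine ⟨?_, fun ⟨i, hi, hpi⟩ => (hc' _).2 ⟨i, ?_, by omega⟩⟩
      · convert (hc' (S.erase p)).1 using 2
        rw [← Finset.add_sum_erase S _ hp]; ring
      · refine Finset.mem_erase.2 ⟨?_, hi⟩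
        rintro rfl
        omega
    · simp only [combine, hp, if_false]
      exact ⟨(hc S).1, fun ⟨i, hi, hpi⟩ => (hc S).2 ⟨i, hi, by omega⟩⟩

lemma stage_indep (h : IsHirsch A A' ι m t e) (p : Fin r) {i j : ℤ} {x y : A'.carrier}
    (hx : x ∈ stage ι m t p i) (hy : y ∈ stage ι m t p j) (hxy : x + y * t p = 0) :
    x = 0 ∧ y = 0 := by
  classical
  obtain ⟨c, hc, rfl⟩ := hx
  obtain ⟨c', hc', rfl⟩ := hy
  rw [← monoSum_combine ι m t p hc hc'] at hxy
  have hz : combine p c c' = 0 := h.monoSum_bijective.1 (by rw [hxy, map_zero])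
  have hconst : c = 0 := funext fun S => by
    by_cases hp : p ∈ S
    · exact (hc S).2 ⟨p, hp, le_rfl⟩
    · simpa [combine, hp] using congrFun hz S
  have hcoeff : c' = 0 := funext fun S => by
    by_cases hp : p ∈ S
    · exact (hc' S).2 ⟨p, hp, le_rfl⟩
    · simpa [combine, hp] using congrFun hz (insert p S)
  simp [hconst, hcoeff]

/-- One stage of a Hirsch extension, given that the previous stage is a subcomplex. -/
lemma isAdjoin_of_d_mem (h : IsHirsch A A' ι m t e) (p : Fin r)
    (hd : ∀ {n x}, x ∈ stage ι m t p n → A'.d x ∈ stage ι m t p (n + 1)) :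
    IsAdjoin A' (stage ι m t p) (stage ι m t (p + 1)) (m p) (t p) (ι.toFun (e p)) where
  le_gr := h.stage_le_gr
  d_mem := hd
  mul_mem := h.mul_mem_stage p
  d_t := h.dt p
  mem_iff := h.mem_stage_succ p
  indep := h.stage_indep p

lemma d_mem_stage (h : IsHirsch A A' ι m t e) {p : ℕ} (hp : p ≤ r) :
    ∀ {n : ℤ} {x : A'.carrier}, x ∈ stage ι m t p n → A'.d x ∈ stage ι m t p (n + 1) := by
  induction p with
  | zero =>
    intro n x hx
    obtain ⟨a, ha, rfl⟩ := h.mem_stage_zero.1 hx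
    exact h.mem_stage_zero.2 ⟨_, CDGA.d_mem_gr ha, ι.map_d a⟩
  | succ p ih =>
    exact (h.isAdjoin_of_d_mem ⟨p, hp⟩ (ih (by omega))).d_mem_adjoin

lemma isAdjoin (h : IsHirsch A A' ι m t e) (p : Fin r) :
    IsAdjoin A' (stage ι m t p) (stage ι m t (p + 1)) (m p) (t p) (ι.toFun (e p)) :=
  h.isAdjoin_of_d_mem p (h.d_mem_stage p.2.le)

/-- The last stage is the whole extension. -/
lemma stage_last (h : IsHirsch A A' ι m t e) : stage ι m t r = A'.gr := by
  classical
  funext n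
  refine le_antisymm (fun x => h.stage_le_gr) fun a ha => ?_
  rcases CDGA.eq_zero_or_mem_grading ha with rfl | ⟨n, rfl, han⟩
  · exact zero_mem _
  obtain ⟨c, rfl⟩ := h.monoSum_bijective.2 a
  let _ := A.decomp
  let _ := A'.decomp
  let c' : Finset (Fin r) → A.carrier := fun S =>
    if ∑ i ∈ S, m i ≤ n then DirectSum.decompose A.grading (c S) (n - ∑ i ∈ S, m i) else 0
  have hproj : ∀ S (b : A.carrier),
      (DirectSum.decompose A'.grading (ι.toFun b * tmono A' t S) n : A'.carrier) =
      ι.toFun (if ∑ i ∈ S, m i ≤ n then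
        (DirectSum.decompose A.grading b (n - ∑ i ∈ S, m i) : A.carrier) else 0)
        * tmono A' t S := by
    intro S b
    induction b using DirectSum.Decomposition.inductionOn A.grading with
    | zero => simp
    | @homogeneous j b =>
      have hb := h.mono_mem S b.2
      by_cases hj : j + ∑ i ∈ S, m i = n
      · subst hj
        rw [DirectSum.decompose_of_mem_same A'.grading hb, if_pos (Nat.le_add_left _ _),
          Nat.add_sub_cancel, DirectSum.decompose_of_mem_same A.grading b.2]
      · rw [DirectSum.decompose_of_mem_ne A'.grading hb hj]
        split_ifs with hle
        · rw [DirectSum.decompose_of_mem_ne A.grading b.2 (by omega)]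
          simp
        · simp
    | add b b' hb hb' =>
      rw [map_add, add_mul, DirectSum.decompose_add, DirectSum.add_apply, Submodule.coe_add,
        hb, hb', ← add_mul, ← map_add]
      congr 2
      split_ifs <;> simp
  refine ⟨c', fun S => ⟨?_, fun ⟨i, _, hi⟩ => absurd i.2 (by omega)⟩, ?_⟩
  · simp only [c']
    split_ifs with hle
    · have : ((n : ℤ) - ∑ i ∈ S, (m i : ℤ)) = ((n - ∑ i ∈ S, m i : ℕ) : ℤ) := by
        push_cast [Nat.cast_sub hle]; rfl
      rw [this, CDGA.gr_natCast]
      exact SetLike.coe_mem _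
    · exact zero_mem _
  · rw [← DirectSum.decompose_of_mem_same A'.grading han]
    rw [monoSum_apply, monoSum_apply, DirectSum.decompose_sum, DirectSum.sum_apply,
      AddSubmonoidClass.coe_finsetSum]
    exact Finset.sum_congr rfl fun S _ => (hproj S (c S)).symm

end IsHirsch

section Statement1

variable {k : Type u} [Field k]

/-- Let `φ : A → B` be a `q`-equivalence of CDGAs, let `P` be a
finite-dimensional graded vector space concentrated in odd degrees, with homogeneous basis
`t_1, …, t_r` of degrees `m_1, …, m_r`, and let `τ : P → Z^{•+1}(A)` be a degree-one linear map
(recorded by the cocycles `e_i = τ(t_i)`).  If `q ≥ max m_i + 1`, then the induced CDGA morphism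
`Φ = φ ⊗ id : A ⊗_τ ΛP → B ⊗_{φ∘τ} ΛP` is a `q`-equivalence. -/
theorem statement1 (A B A' B' : CDGA k) (φ : CDGAHom A B) (q : ℕ)
    (hφ : φ.IsQEquiv q)
    (r : ℕ) (m : Fin r → ℕ)
    (t : Fin r → A'.carrier) (s : Fin r → B'.carrier) (e : Fin r → A.carrier)
    (ιA : CDGAHom A A') (ιB : CDGAHom B B')
    (hA' : IsHirsch A A' ιA m t e)
    (hB' : IsHirsch B B' ιB m s (fun i => φ.toFun (e i)))
    (hq : ∀ i, m i + 1 ≤ q)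
    (Φ : CDGAHom A' B')
    (hΦι : ∀ x : A.carrier, Φ.toFun (ιA.toFun x) = ιB.toFun (φ.toFun x))
    (hΦt : ∀ i, Φ.toFun (t i) = s i) :
    Φ.IsQEquiv q := by
  have hstage : ∀ {p : ℕ} {n : ℤ} {x : A'.carrier}, x ∈ stage ιA m t p n →
      Φ.toFun x ∈ stage ιB m s p n := by
    rintro p n _ ⟨c, hc, rfl⟩
    refine ⟨fun S => φ.toFun (c S), fun S => ⟨φ.map_gr (hc S).1, fun h => by
      simp [(hc S).2 h]⟩, ?_⟩
    simp [monoSum_apply, hΦι, CDGAHom.map_tmono, hΦt]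
  have key : ∀ p ≤ r, Φ.IsQEquivOn (stage ιA m t p) (stage ιB m s p) q := by
    intro p
    induction p with
    | zero =>
      intro _
      obtain ⟨hs, hi⟩ := (φ.isQEquiv_iff_isQEquivOn_gr q).1 hφ
      refine ⟨fun n hn b hb hdb => ?_, fun n hn a ha hda w hw haw => ?_⟩
      · obtain ⟨b, hb₀, rfl⟩ := hB'.mem_stage_zero.1 hb
        obtain ⟨a, ha, hda, w, hw, haw⟩ := hs n hn b hb₀
          (hB'.inj (by rw [ιB.map_d, hdb, map_zero]))
        refine ⟨_, hA'.mem_stage_zero.2 ⟨a, ha, rfl⟩, by rw [← ιA.map_d, hda, map_zero],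
          _, hB'.mem_stage_zero.2 ⟨w, hw, rfl⟩, ?_⟩
        rw [hΦι, ← map_sub, haw, ιB.map_d]
      · obtain ⟨a, ha₀, rfl⟩ := hA'.mem_stage_zero.1 ha
        obtain ⟨w, hw₀, rfl⟩ := hB'.mem_stage_zero.1 hw
        obtain ⟨x, hx, rfl⟩ := hi n hn a ha₀ (hA'.inj (by rw [ιA.map_d, hda, map_zero]))
          w hw₀ (hB'.inj (by rw [← hΦι, haw, ιB.map_d]))
        exact ⟨_, hA'.mem_stage_zero.2 ⟨x, hx, rfl⟩, ιA.map_d x⟩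
    | succ p ih =>
      intro hp
      exact (ih (by omega)).adjoin (hA'.isAdjoin ⟨p, hp⟩) (hB'.isAdjoin ⟨p, hp⟩) hstage (hΦt _)
  rw [Φ.isQEquiv_iff_isQEquivOn_gr, ← hA'.stage_last, ← hB'.stage_last]
  exact key r le_rfl

end Statement1
end
end

section
/- Let B be a connected CDGA over k and let e ∈ Z²(B) with [e] ≠ 0 in H²(B), and let A = B ⊗_e Λ(t) be the Hirsch extension with one generator t of degree 1 and dt = e. Then for every ω ∈ Z¹(B) = Z¹(A), the canonical inclusion φ : B ↪ A induces an isomorphism H¹(B, d_ω) ≅ H¹(A, d_ω). Consequently ℛ¹_s(A) = ℛ¹_s(B) for all s ≥ 0. -/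
noncomputable section
set_option synthInstance.maxHeartbeats 1000000
set_option maxHeartbeats 1600000
set_option linter.unusedVariables false

open scoped TensorProduct

universe u v

section RankOne

variable {k : Type u} [Field k]

/-- The covariant derivative `d_ω = d + ω·(-)` associated to a rank-one flat connection. -/
def covD (A : CDGA k) (ω : A.carrier) : A.carrier →ₗ[k] A.carrier :=
  A.d + LinearMap.mulLeft k ω

/-- `d_ω`-cocycles in degree `i`. -/
def ZcOm (A : CDGA k) (ω : A.carrier) (i : ℕ) : Submodule k A.carrier :=
  A.grading i ⊓ LinearMap.ker (covD A ω)

/-- `d_ω`-coboundaries in degree `i`. -/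
def BcOm (A : CDGA k) (ω : A.carrier) : ℕ → Submodule k A.carrier
  | 0 => ⊥
  | (i + 1) => (A.grading i).map (covD A ω)

/-- The cohomology `H^i(A, d_ω)`. -/
abbrev cohOm (A : CDGA k) (ω : A.carrier) (i : ℕ) :=
  ↥(ZcOm A ω i) ⧸ (Submodule.comap (ZcOm A ω i).subtype (BcOm A ω i))

/-- The rank-one resonance variety `ℛ^i_s(A) = {ω ∈ Z¹(A) | dim H^i(A,d_ω) ≥ s}`. -/
def res1 (A : CDGA k) (i s : ℕ) : Set A.carrier :=
  {ω | ω ∈ A.Zc 1 ∧ (s : Cardinal) ≤ Module.rank k (cohOm A ω i)}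

end RankOne

section HirschDegreeOne

variable {k : Type u} [Field k]

/-- A linear map of degree `m` commutes with the projections to homogeneous components. -/
theorem CDGA.decompose_map_of_degree {B A : CDGA k} (f : B.carrier →ₗ[k] A.carrier) (m : ℕ)
    (hf : ∀ i, ∀ b ∈ B.grading i, f b ∈ A.grading (i + m)) (b : B.carrier) (n : ℕ) :
    letI := A.decomp
    letI := B.decomp
    (DirectSum.decompose A.grading (f b) (n + m) : A.carrier) =
      f (DirectSum.decompose B.grading b n) := by
  let _ := A.decomp
  let _ := B.decomp
  induction b using DirectSum.Decomposition.inductionOn B.grading with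
  | zero => simp
  | @homogeneous i b =>
    by_cases h : i = n
    · subst h
      rw [DirectSum.decompose_of_mem_same _ (hf _ _ b.2), DirectSum.decompose_coe,
        DirectSum.of_eq_same]
    · rw [DirectSum.decompose_of_mem_ne _ (hf _ _ b.2) (by omega),
        DirectSum.decompose_of_mem_ne _ b.2 h, map_zero]
  | add a b ha hb => simp [DirectSum.decompose_add, ha, hb]

/-- A linear map of positive degree has no component in degree zero. -/
theorem CDGA.decompose_map_of_degree_zero {B A : CDGA k} (f : B.carrier →ₗ[k] A.carrier) (m : ℕ)
    (hm : 0 < m) (hf : ∀ i, ∀ b ∈ B.grading i, f b ∈ A.grading (i + m)) (b : B.carrier) :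
    letI := A.decomp
    (DirectSum.decompose A.grading (f b) 0 : A.carrier) = 0 := by
  let _ := A.decomp
  let _ := B.decomp
  induction b using DirectSum.Decomposition.inductionOn B.grading with
  | zero => simp
  | @homogeneous i b => exact DirectSum.decompose_of_mem_ne _ (hf _ _ b.2) (by omega)
  | add a b ha hb => simp [DirectSum.decompose_add, ha, hb]

/-- The twisted differentials commute with a morphism of CDGAs. -/
theorem CDGAHom.map_covD {B A : CDGA k} (φ : CDGAHom B A) (ω b : B.carrier) :
    φ.toFun (covD B ω b) = covD A (φ.toFun ω) (φ.toFun b) := by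
  simp [covD, φ.map_d]

theorem covD_zero (A : CDGA k) : covD A 0 = A.d := by
  ext x
  simp [covD]

theorem ZcOm_zero (A : CDGA k) (i : ℕ) : ZcOm A 0 i = A.Zc i := by
  rw [ZcOm, covD_zero, CDGA.Zc]

theorem sum_tmono_fin_one {B A : CDGA k} (φ : CDGAHom B A) (t : A.carrier)
    (c : Finset (Fin 1) → B.carrier) :
    ∑ S : Finset (Fin 1), φ.toFun (c S) * tmono A (fun _ => t) S =
      φ.toFun (c ∅) + φ.toFun (c {0}) * t := by
  have h : (Finset.univ : Finset (Finset (Fin 1))) = {∅, {0}} := by decide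
  rw [h, Finset.sum_pair (by decide)]
  simp [tmono]

namespace IsHirsch

variable {B A : CDGA k} {φ : CDGAHom B A} {t : A.carrier} {e : B.carrier}

theorem exists_eq_add_mul
    (hhir : IsHirsch B A φ (fun _ : Fin 1 => 1) (fun _ => t) (fun _ => e))
    (a : A.carrier) :
    ∃ b c : B.carrier, a = φ.toFun b + φ.toFun c * t := by
  obtain ⟨c, hc, -⟩ := hhir.free a
  exact ⟨c ∅, c {0}, hc.trans (sum_tmono_fin_one φ t c)⟩

theorem eq_zero_of_add_mul_eq_zero
    (hhir : IsHirsch B A φ (fun _ : Fin 1 => 1) (fun _ => t) (fun _ => e))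
    {b c : B.carrier} (h : φ.toFun b + φ.toFun c * t = 0) :
    b = 0 ∧ c = 0 := by
  obtain ⟨u, -, hu⟩ := hhir.free 0
  have h₁ := hu (fun S => if S = ∅ then b else c) (by
    simp only [sum_tmono_fin_one]
    simpa using h.symm)
  have h₂ := hu (fun _ => 0) (by simp)
  have h₃ := h₁.trans h₂.symm
  exact ⟨by simpa using congrFun h₃ ∅, by simpa using congrFun h₃ {0}⟩

theorem mulRight_mem
    (hhir : IsHirsch B A φ (fun _ : Fin 1 => 1) (fun _ => t) (fun _ => e))
    (i : ℕ) (b : B.carrier) (hb : b ∈ B.grading i) :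
    (LinearMap.mulRight k t ∘ₗ φ.toFun.toLinearMap) b ∈ A.grading (i + 1) :=
  A.mul_mem (φ.map_grading hb) (hhir.t_mem 0)

theorem exists_of_mem_grading_zero
    (hhir : IsHirsch B A φ (fun _ : Fin 1 => 1) (fun _ => t) (fun _ => e))
    {a : A.carrier} (ha : a ∈ A.grading 0) :
    ∃ b ∈ B.grading 0, φ.toFun b = a := by
  let _ := A.decomp
  let _ := B.decomp
  obtain ⟨b, c, h⟩ := hhir.exists_eq_add_mul a
  have hb := CDGA.decompose_map_of_degree φ.toFun.toLinearMap 0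
    (fun i b hb => φ.map_grading hb) b 0
  have hc := CDGA.decompose_map_of_degree_zero _ 1 one_pos hhir.mulRight_mem c
  refine ⟨_, (DirectSum.decompose B.grading b 0).2, ?_⟩
  have := DirectSum.decompose_of_mem_same _ ha
  rw [h, DirectSum.decompose_add] at this
  simp at hb hc this
  rw [h, ← this, hc, hb, ZeroMemClass.coe_zero, add_zero]

theorem exists_of_mem_grading_one
    (hhir : IsHirsch B A φ (fun _ : Fin 1 => 1) (fun _ => t) (fun _ => e))
    (hBconn : B.Connected) {a : A.carrier}
    (ha : a ∈ A.grading 1) :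
    ∃ b ∈ B.grading 1, ∃ l : k, a = φ.toFun b + l • t := by
  let _ := A.decomp
  let _ := B.decomp
  obtain ⟨b, c, h⟩ := hhir.exists_eq_add_mul a
  have hb := CDGA.decompose_map_of_degree φ.toFun.toLinearMap 0
    (fun i b hb => φ.map_grading hb) b 1
  have hc := CDGA.decompose_map_of_degree _ 1 hhir.mulRight_mem c 0
  obtain ⟨l, hl⟩ := Submodule.mem_span_singleton.mp
    (hBconn.le (DirectSum.decompose B.grading c 0).2)
  refine ⟨_, (DirectSum.decompose B.grading b 1).2, l, ?_⟩
  have := DirectSum.decompose_of_mem_same _ ha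
  rw [h, DirectSum.decompose_add] at this
  rw [← hl] at hc
  simp at hb hc this
  rw [h, ← this, hc, hb]

/-- Since `[e] ≠ 0`, every twisted one-cocycle of the extension comes from the base. -/
theorem exists_of_mem_ZcOm_one
    (hhir : IsHirsch B A φ (fun _ : Fin 1 => 1) (fun _ => t) (fun _ => e))
    (hBconn : B.Connected) (hne : e ∉ B.Bc 2) (ω : B.carrier)
    {x : A.carrier} (hx : x ∈ ZcOm A (φ.toFun ω) 1) : ∃ y ∈ ZcOm B ω 1, φ.toFun y = x := by
  obtain ⟨hx₁, hx₂⟩ := hx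
  obtain ⟨b, hb, l, rfl⟩ := hhir.exists_of_mem_grading_one hBconn hx₁
  have hdt : covD A (φ.toFun ω) t = φ.toFun e + φ.toFun ω * t := by
    simp [covD, hhir.dt 0]
  have key : φ.toFun (covD B ω b + l • e) + φ.toFun (l • ω) * t = 0 := by
    rw [SetLike.mem_coe, LinearMap.mem_ker, map_add, map_smul, hdt, ← φ.map_covD] at hx₂
    rw [← hx₂]
    simp [add_assoc]
  obtain ⟨h₁, h₂⟩ := hhir.eq_zero_of_add_mul_eq_zero key
  have hl : l = 0 := by
    by_contra hl
    have hω : ω = 0 := (smul_eq_zero.mp h₂).resolve_left hl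
    subst hω
    rw [covD_zero] at h₁
    refine hne ⟨-l⁻¹ • b, Submodule.smul_mem _ _ hb, ?_⟩
    rw [map_smul, eq_neg_of_add_eq_zero_left h₁, neg_smul_neg, smul_smul, inv_mul_cancel₀ hl,
      one_smul]
  subst hl
  exact ⟨b, ⟨hb, by simpa using h₁⟩, by simp⟩

theorem mem_BcOm_one_of_map_mem
    (hhir : IsHirsch B A φ (fun _ : Fin 1 => 1) (fun _ => t) (fun _ => e))
    (ω : B.carrier) {y : B.carrier}
    (hy : φ.toFun y ∈ BcOm A (φ.toFun ω) 1) : y ∈ BcOm B ω 1 := by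
  obtain ⟨a, ha, hay⟩ := hy
  obtain ⟨b, hb, rfl⟩ := hhir.exists_of_mem_grading_zero ha
  exact ⟨b, hb, hhir.inj ((φ.map_covD ω b).trans hay)⟩

end IsHirsch

theorem CDGAHom.map_mem_ZcOm {B A : CDGA k} (φ : CDGAHom B A) {ω y : B.carrier} {i : ℕ}
    (hy : y ∈ ZcOm B ω i) : φ.toFun y ∈ ZcOm A (φ.toFun ω) i :=
  ⟨φ.map_grading hy.1, by
    rw [SetLike.mem_coe, LinearMap.mem_ker, ← φ.map_covD, LinearMap.mem_ker.mp hy.2, map_zero]⟩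

theorem CDGAHom.map_mem_BcOm {B A : CDGA k} (φ : CDGAHom B A) {ω y : B.carrier} {i : ℕ}
    (hy : y ∈ BcOm B ω i) : φ.toFun y ∈ BcOm A (φ.toFun ω) i := by
  cases i with
  | zero =>
    rw [(Submodule.mem_bot k).mp hy, map_zero]
    exact Submodule.zero_mem _
  | succ i =>
    obtain ⟨b, hb, rfl⟩ := hy
    exact ⟨φ.toFun b, φ.map_grading hb, (φ.map_covD ω b).symm⟩

/-- The map induced on twisted cohomology by a morphism of CDGAs. -/
def CDGAHom.cohMap {B A : CDGA k} (φ : CDGAHom B A) (ω : B.carrier) (i : ℕ) :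
    cohOm B ω i →ₗ[k] cohOm A (φ.toFun ω) i :=
  Submodule.mapQ _ _ (φ.toFun.toLinearMap.restrict fun _ hy => φ.map_mem_ZcOm hy)
    fun _ hy => φ.map_mem_BcOm hy

theorem IsHirsch.cohMap_one_bijective {B A : CDGA k} {φ : CDGAHom B A} {t : A.carrier}
    {e : B.carrier} (hhir : IsHirsch B A φ (fun _ : Fin 1 => 1) (fun _ => t) (fun _ => e))
    (hBconn : B.Connected) (hne : e ∉ B.Bc 2) (ω : B.carrier) :
    Function.Bijective (φ.cohMap ω 1) := by
  constructor
  · rw [injective_iff_map_eq_zero]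
    intro y hy
    obtain ⟨y, rfl⟩ := Submodule.Quotient.mk_surjective _ y
    have hy : φ.toFun y ∈ BcOm A (φ.toFun ω) 1 := (Submodule.Quotient.mk_eq_zero
      ((BcOm A (φ.toFun ω) 1).comap (ZcOm A (φ.toFun ω) 1).subtype)
      (x := Subtype.mk (φ.toFun y) (φ.map_mem_ZcOm y.2))).mp hy
    exact (Submodule.Quotient.mk_eq_zero _).mpr (hhir.mem_BcOm_one_of_map_mem ω hy)
  · intro x
    obtain ⟨⟨x, hx⟩, rfl⟩ := Submodule.Quotient.mk_surjective _ x
    obtain ⟨y, hy, rfl⟩ := hhir.exists_of_mem_ZcOm_one hBconn hne ω hx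
    exact ⟨Submodule.Quotient.mk ⟨y, hy⟩, rfl⟩

theorem IsHirsch.natCast_le_rank_cohOm_one_iff {B A : CDGA k} {φ : CDGAHom B A} {t : A.carrier}
    {e : B.carrier} (hhir : IsHirsch B A φ (fun _ : Fin 1 => 1) (fun _ => t) (fun _ => e))
    (hBconn : B.Connected) (hne : e ∉ B.Bc 2) (ω : B.carrier) (s : ℕ) :
    (s : Cardinal) ≤ Module.rank k (cohOm A (φ.toFun ω) 1) ↔
      (s : Cardinal) ≤ Module.rank k (cohOm B ω 1) := by
  have h := (LinearEquiv.ofBijective _ (hhir.cohMap_one_bijective hBconn hne ω)).lift_rank_eq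
  rw [← Cardinal.nat_le_lift_iff, ← h, Cardinal.nat_le_lift_iff]

end HirschDegreeOne

section Statement8

variable {k : Type u} [Field k]

/-- Let `B` be a connected CDGA, `e ∈ Z²(B)` with `[e] ≠ 0` in `H²(B)`, and
let `A = B ⊗_e Λ(t)` be the Hirsch extension with one degree-one generator `t` and `dt = e`.
Then for every `ω ∈ Z¹(B) = Z¹(A)`, the canonical inclusion `φ : B ↪ A` induces an isomorphism
`H¹(B, d_ω) ≅ H¹(A, d_ω)` (expressed below as surjectivity and injectivity of the induced map
on degree-one `d_ω`-cohomology).  Consequently `ℛ¹_s(A) = ℛ¹_s(B)` for all `s ≥ 0`. -/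
theorem statement8 (B A : CDGA k) (hBconn : B.Connected)
    (φ : CDGAHom B A) (t : A.carrier) (e : B.carrier)
    (hhir : IsHirsch B A φ (fun _ : Fin 1 => 1) (fun _ => t) (fun _ => e))
    (hne : e ∉ B.Bc 2) :
    (∀ ω ∈ B.Zc 1,
      (∀ x ∈ ZcOm A (φ.toFun ω) 1, ∃ y ∈ ZcOm B ω 1,
          φ.toFun y - x ∈ BcOm A (φ.toFun ω) 1) ∧
      (∀ y ∈ ZcOm B ω 1, φ.toFun y ∈ BcOm A (φ.toFun ω) 1 → y ∈ BcOm B ω 1)) ∧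
    (∀ s : ℕ, res1 A 1 s = φ.toFun '' (res1 B 1 s)) := by
  refine ⟨fun ω _ => ⟨fun x hx => ?_, fun y _ hy => hhir.mem_BcOm_one_of_map_mem ω hy⟩,
    fun s => Set.ext fun ω' => ⟨?_, ?_⟩⟩
  · obtain ⟨y, hy, rfl⟩ := hhir.exists_of_mem_ZcOm_one hBconn hne ω hx
    exact ⟨y, hy, by simp⟩
  · rintro ⟨hω', hs⟩
    rw [← ZcOm_zero, ← map_zero φ.toFun] at hω'
    obtain ⟨ω, hω, rfl⟩ := hhir.exists_of_mem_ZcOm_one hBconn hne 0 hω'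
    rw [ZcOm_zero] at hω
    exact ⟨ω, ⟨hω, (hhir.natCast_le_rank_cohOm_one_iff hBconn hne ω s).mp hs⟩, rfl⟩
  · rintro ⟨ω, ⟨hω, hs⟩, rfl⟩
    refine ⟨?_, (hhir.natCast_le_rank_cohOm_one_iff hBconn hne ω s).mpr hs⟩
    rw [← ZcOm_zero] at hω ⊢
    simpa using φ.map_mem_ZcOm hω

end Statement8
end
end

section
/- Let B be a connected CDGA over k, let e ∈ Z²(B), let A = B ⊗_e Λ(t) be the Hirsch extension with one generator t of degree 1 and dt = e, and let ω ∈ Z¹(B) ⊆ Z¹(A). Then (B^•, d_ω) is a subcomplex of (A^•, d_ω) via the canonical inclusion, and the quotient complex (A/B)^• is isomorphic to the shifted complex (B^{•−1}, −d_ω) (via the identification sending the class of t·b to b ∈ B^{•−1}). In particular, there is a long exact sequence ⋯ → H^{i−2}(B, d_ω) → H^i(B, d_ω) → H^i(A, d_ω) → H^{i−1}(B, d_ω) → H^{i+1}(B, d_ω) → ⋯. -/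
noncomputable section
set_option synthInstance.maxHeartbeats 1000000
set_option maxHeartbeats 1600000
set_option linter.unusedVariables false

open scoped TensorProduct

universe u v

section Statement9

variable {k : Type u} [Field k]

/-- The map `b ↦ class of t·φ(b)` from `B` to the quotient `A / φ(B)`. -/
def quotMap (B A : CDGA k) (φ : CDGAHom B A) (t : A.carrier) :
    B.carrier →ₗ[k] (A.carrier ⧸ LinearMap.range φ.toFun.toLinearMap) :=
  (LinearMap.range φ.toFun.toLinearMap).mkQ ∘ₗ
    (LinearMap.mulLeft k t) ∘ₗ φ.toFun.toLinearMap

namespace CDGA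

theorem linearMap_ext_of_homogeneous (A : CDGA k) {M : Type*} [AddCommGroup M] [Module k M]
    {f g : A.carrier →ₗ[k] M} (h : ∀ i, ∀ a ∈ A.grading i, f a = g a) : f = g := by
  let := A.decomp
  ext a
  induction a using DirectSum.Decomposition.inductionOn A.grading with
  | zero => simp
  | homogeneous x => exact h _ _ x.2
  | add x y hx hy => rw [map_add, map_add, hx, hy]

/-- The projection onto the homogeneous component of degree `i`. -/
def homogProj (A : CDGA k) (i : ℕ) : A.carrier →ₗ[k] A.carrier :=
  letI := A.decomp
  (A.grading i).subtype ∘ₗ DirectSum.component k ℕ (fun j => A.grading j) i ∘ₗ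
    (DirectSum.decomposeLinearEquiv A.grading).toLinearMap

theorem homogProj_mem (A : CDGA k) (i : ℕ) (a : A.carrier) : A.homogProj i a ∈ A.grading i :=
  Subtype.property _

theorem homogProj_of_mem (A : CDGA k) {i : ℕ} {a : A.carrier} (ha : a ∈ A.grading i) :
    A.homogProj i a = a := by
  let := A.decomp
  exact DirectSum.decompose_of_mem_same A.grading ha

theorem homogProj_of_mem_ne (A : CDGA k) {i j : ℕ} {a : A.carrier} (ha : a ∈ A.grading j)
    (hij : j ≠ i) : A.homogProj i a = 0 := by
  let := A.decomp
  exact DirectSum.decompose_of_mem_ne A.grading ha hij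

/-- The degree involution, acting by `(-1)^i` in degree `i`. -/
def degreeInvolution (A : CDGA k) : A.carrier →ₗ[k] A.carrier :=
  letI := A.decomp
  DirectSum.toModule k ℕ A.carrier (fun j => (-1 : k) ^ j • (A.grading j).subtype) ∘ₗ
    (DirectSum.decomposeLinearEquiv A.grading).toLinearMap

theorem degreeInvolution_of_mem (A : CDGA k) {i : ℕ} {a : A.carrier} (ha : a ∈ A.grading i) :
    A.degreeInvolution a = (-1 : k) ^ i • a := by
  let := A.decomp
  simp only [degreeInvolution, LinearMap.comp_apply, LinearEquiv.coe_coe,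
    DirectSum.decomposeLinearEquiv_apply]
  rw [DirectSum.decompose_of_mem A.grading ha]
  erw [DirectSum.toModule_lof]
  rfl

theorem degreeInvolution_involutive (A : CDGA k) (a : A.carrier) :
    A.degreeInvolution (A.degreeInvolution a) = a := by
  refine LinearMap.congr_fun (f := A.degreeInvolution ∘ₗ A.degreeInvolution)
    (g := LinearMap.id) (A.linearMap_ext_of_homogeneous fun i a ha => ?_) a
  simp only [LinearMap.comp_apply, LinearMap.id_apply]
  rw [degreeInvolution_of_mem A ha, map_smul, degreeInvolution_of_mem A ha, smul_smul,
    ← mul_pow]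
  simp

end CDGA

theorem covD_apply (A : CDGA k) (ω a : A.carrier) : covD A ω a = A.d a + ω * a := rfl

theorem covD_mem {A : CDGA k} {ω : A.carrier} (hω : ω ∈ A.grading 1) {i : ℕ} {a : A.carrier}
    (ha : a ∈ A.grading i) : covD A ω a ∈ A.grading (i + 1) :=
  add_mem (A.d_mem ha) (add_comm 1 i ▸ A.mul_mem hω ha)

theorem covD_cocycle_mul {A : CDGA k} {ω e : A.carrier} (hω : ω ∈ A.Zc 1) (he : e ∈ A.Zc 2)
    (a : A.carrier) : covD A ω (e * a) = e * covD A ω a := by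
  have hde : A.d e = 0 := he.2
  have hcomm : ω * e = e * ω := by simpa using A.gcomm hω.1 he.1
  simp only [covD_apply, A.leibniz he.1, hde, mul_add, ← mul_assoc, hcomm]
  simp

theorem covD_map {A B : CDGA k} (φ : CDGAHom B A) (ω x : B.carrier) :
    covD A (φ.toFun ω) (φ.toFun x) = φ.toFun (covD B ω x) := by
  simp [covD_apply, φ.map_d]

/-- The map on `d_ω`-cohomology induced by a linear map that preserves cocycles, and sends
cocycles which are coboundaries to coboundaries. -/
def cohOmMap {A B : CDGA k} {ω : A.carrier} {η : B.carrier} {i j : ℕ}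
    (f : A.carrier →ₗ[k] B.carrier) (hZ : ∀ x ∈ ZcOm A ω i, f x ∈ ZcOm B η j)
    (hB : ∀ x ∈ ZcOm A ω i, x ∈ BcOm A ω i → f x ∈ BcOm B η j) :
    cohOm A ω i →ₗ[k] cohOm B η j :=
  Submodule.mapQ _ _ (f.restrict hZ) fun x hx => hB x x.2 hx

theorem cohOmMap_mk {A B : CDGA k} {ω : A.carrier} {η : B.carrier} {i j : ℕ}
    (f : A.carrier →ₗ[k] B.carrier) (hZ : ∀ x ∈ ZcOm A ω i, f x ∈ ZcOm B η j)
    (hB : ∀ x ∈ ZcOm A ω i, x ∈ BcOm A ω i → f x ∈ BcOm B η j) (x : ZcOm A ω i) :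
    cohOmMap f hZ hB (Submodule.Quotient.mk x) = Submodule.Quotient.mk ⟨f x, hZ x x.2⟩ := rfl

theorem cohOm_mk_eq_zero {A : CDGA k} {ω : A.carrier} {i : ℕ} (x : ZcOm A ω i) :
    (Submodule.Quotient.mk x : cohOm A ω i) = 0 ↔ (x : A.carrier) ∈ BcOm A ω i :=
  Submodule.Quotient.mk_eq_zero _

theorem cohOm_mk_eq {A : CDGA k} {ω : A.carrier} {i : ℕ} (x y : ZcOm A ω i) :
    (Submodule.Quotient.mk x : cohOm A ω i) = Submodule.Quotient.mk y ↔
      (x : A.carrier) - y ∈ BcOm A ω i :=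
  Submodule.Quotient.eq _

namespace IsHirsch

variable {B A : CDGA k} {φ : CDGAHom B A} {t : A.carrier} {e : B.carrier}

theorem mul_generator (h : IsHirsch B A φ (fun _ : Fin 1 => 1) (fun _ => t) (fun _ => e))
    (b : B.carrier) : φ.toFun b * t = t * φ.toFun (B.degreeInvolution b) := by
  refine LinearMap.congr_fun (f := LinearMap.mulRight k t ∘ₗ φ.toFun.toLinearMap)
    (g := LinearMap.mulLeft k t ∘ₗ φ.toFun.toLinearMap ∘ₗ B.degreeInvolution)
    (B.linearMap_ext_of_homogeneous fun i b hb => ?_) b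
  have := A.gcomm (φ.map_grading hb) (h.t_mem 0)
  simp [B.degreeInvolution_of_mem hb, this]

/-- The map `(b₁, b₂) ↦ b₁ + t·b₂`. -/
def ofCoeffs (φ : CDGAHom B A) (t : A.carrier) : B.carrier × B.carrier →ₗ[k] A.carrier :=
  φ.toFun.toLinearMap.coprod (LinearMap.mulLeft k t ∘ₗ φ.toFun.toLinearMap)

theorem sum_tmono (t : A.carrier) (c : Finset (Fin 1) → B.carrier) :
    ∑ S : Finset (Fin 1), φ.toFun (c S) * tmono A (fun _ => t) S =
      φ.toFun (c ∅) + φ.toFun (c {0}) * t := by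
  have huniv : (Finset.univ : Finset (Finset (Fin 1))) = {∅, {0}} := by decide
  rw [huniv, Finset.sum_pair (by decide)]
  simp [tmono]

theorem ofCoeffs_bijective
    (h : IsHirsch B A φ (fun _ : Fin 1 => 1) (fun _ => t) (fun _ => e)) :
    Function.Bijective (ofCoeffs φ t) := by
  constructor
  · rw [← LinearMap.ker_eq_bot, LinearMap.ker_eq_bot']
    rintro ⟨b₁, b₂⟩ hb
    have hb' : φ.toFun b₁ + φ.toFun (B.degreeInvolution b₂) * t = 0 := by
      rw [h.mul_generator, B.degreeInvolution_involutive]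
      exact hb
    obtain ⟨c, -, hc⟩ := h.free 0
    have h₁ := hc (fun S => if S = ∅ then b₁ else B.degreeInvolution b₂) (by
      beta_reduce
      rw [sum_tmono]
      simpa using hb'.symm)
    have h₂ := hc (fun _ => 0) (by simp)
    have h₃ := h₁.trans h₂.symm
    have e₁ : b₁ = 0 := by simpa using congr_fun h₃ ∅
    have e₂ : B.degreeInvolution b₂ = 0 := by simpa using congr_fun h₃ {0}
    rw [Prod.mk_eq_zero]
    refine ⟨e₁, ?_⟩
    rw [← B.degreeInvolution_involutive b₂, e₂, map_zero]
  · intro a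
    obtain ⟨c, hc, -⟩ := h.free a
    refine ⟨(c ∅, B.degreeInvolution (c {0})), ?_⟩
    rw [hc, sum_tmono, h.mul_generator]
    rfl

/-- The identification `B ⊕ t·B ≃ A` of the underlying vector spaces. -/
def coeffsEquiv (h : IsHirsch B A φ (fun _ : Fin 1 => 1) (fun _ => t) (fun _ => e)) :
    (B.carrier × B.carrier) ≃ₗ[k] A.carrier :=
  LinearEquiv.ofBijective (ofCoeffs φ t) h.ofCoeffs_bijective

/-- The projection of `B ⊗ Λ(t)` onto the coefficient of `t`. -/
def generatorCoeff (h : IsHirsch B A φ (fun _ : Fin 1 => 1) (fun _ => t) (fun _ => e)) :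
    A.carrier →ₗ[k] B.carrier :=
  LinearMap.snd k _ _ ∘ₗ h.coeffsEquiv.symm.toLinearMap

theorem generatorCoeff_apply
    (h : IsHirsch B A φ (fun _ : Fin 1 => 1) (fun _ => t) (fun _ => e)) (b₁ b₂ : B.carrier) :
    h.generatorCoeff (φ.toFun b₁ + t * φ.toFun b₂) = b₂ := by
  have : φ.toFun b₁ + t * φ.toFun b₂ = h.coeffsEquiv (b₁, b₂) := rfl
  rw [this]
  simp [generatorCoeff]

theorem coeffs_unique
    (h : IsHirsch B A φ (fun _ : Fin 1 => 1) (fun _ => t) (fun _ => e))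
    {b₁ b₂ c₁ c₂ : B.carrier}
    (hbc : φ.toFun b₁ + t * φ.toFun b₂ = φ.toFun c₁ + t * φ.toFun c₂) : b₁ = c₁ ∧ b₂ = c₂ :=
  Prod.mk_inj.1 (h.ofCoeffs_bijective.1 (a₁ := (b₁, b₂)) (a₂ := (c₁, c₂)) hbc)

theorem homogProj_map (φ : CDGAHom B A) (i : ℕ) (b : B.carrier) :
    A.homogProj i (φ.toFun b) = φ.toFun (B.homogProj i b) := by
  refine LinearMap.congr_fun (f := A.homogProj i ∘ₗ φ.toFun.toLinearMap)
    (g := φ.toFun.toLinearMap ∘ₗ B.homogProj i)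
    (B.linearMap_ext_of_homogeneous fun j b hb => ?_) b
  obtain rfl | hij := eq_or_ne j i
  · simp [A.homogProj_of_mem (φ.map_grading hb), B.homogProj_of_mem hb]
  · simp [A.homogProj_of_mem_ne (φ.map_grading hb) hij, B.homogProj_of_mem_ne hb hij]

theorem generator_mul_mem
    (h : IsHirsch B A φ (fun _ : Fin 1 => 1) (fun _ => t) (fun _ => e))
    {i : ℕ} {b : B.carrier} (hb : b ∈ B.grading i) : t * φ.toFun b ∈ A.grading (i + 1) :=
  add_comm 1 i ▸ A.mul_mem (h.t_mem 0) (φ.map_grading hb)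

theorem homogProj_generator_mul
    (h : IsHirsch B A φ (fun _ : Fin 1 => 1) (fun _ => t) (fun _ => e)) (i : ℕ)
    (b : B.carrier) :
    A.homogProj (i + 1) (t * φ.toFun b) = t * φ.toFun (B.homogProj i b) := by
  refine LinearMap.congr_fun
    (f := A.homogProj (i + 1) ∘ₗ LinearMap.mulLeft k t ∘ₗ φ.toFun.toLinearMap)
    (g := LinearMap.mulLeft k t ∘ₗ φ.toFun.toLinearMap ∘ₗ B.homogProj i)
    (B.linearMap_ext_of_homogeneous fun j b hb => ?_) b
  obtain rfl | hij := eq_or_ne j i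
  · simp [A.homogProj_of_mem (h.generator_mul_mem hb), B.homogProj_of_mem hb]
  · simp [A.homogProj_of_mem_ne (h.generator_mul_mem hb) (i := i + 1) (by omega),
      B.homogProj_of_mem_ne hb hij]

theorem homogProj_zero_generator_mul
    (h : IsHirsch B A φ (fun _ : Fin 1 => 1) (fun _ => t) (fun _ => e)) (b : B.carrier) :
    A.homogProj 0 (t * φ.toFun b) = 0 := by
  refine LinearMap.congr_fun
    (f := A.homogProj 0 ∘ₗ LinearMap.mulLeft k t ∘ₗ φ.toFun.toLinearMap) (g := 0)
    (B.linearMap_ext_of_homogeneous fun j b hb => ?_) b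
  simp [A.homogProj_of_mem_ne (h.generator_mul_mem hb) (i := 0) (by omega)]

theorem exists_coeffs_of_mem_succ
    (h : IsHirsch B A φ (fun _ : Fin 1 => 1) (fun _ => t) (fun _ => e)) {i : ℕ}
    {a : A.carrier} (ha : a ∈ A.grading (i + 1)) :
    ∃ b₁ ∈ B.grading (i + 1), ∃ b₂ ∈ B.grading i, a = φ.toFun b₁ + t * φ.toFun b₂ := by
  obtain ⟨⟨b₁, b₂⟩, hb : φ.toFun b₁ + t * φ.toFun b₂ = a⟩ := h.ofCoeffs_bijective.2 a
  refine ⟨_, B.homogProj_mem _ b₁, _, B.homogProj_mem _ b₂, ?_⟩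
  rw [← homogProj_map, ← h.homogProj_generator_mul, ← map_add, hb, A.homogProj_of_mem ha]

theorem exists_coeff_of_mem_zero
    (h : IsHirsch B A φ (fun _ : Fin 1 => 1) (fun _ => t) (fun _ => e))
    {a : A.carrier} (ha : a ∈ A.grading 0) : ∃ b ∈ B.grading 0, a = φ.toFun b := by
  obtain ⟨⟨b₁, b₂⟩, hb : φ.toFun b₁ + t * φ.toFun b₂ = a⟩ := h.ofCoeffs_bijective.2 a
  refine ⟨_, B.homogProj_mem 0 b₁, ?_⟩
  rw [← homogProj_map, ← add_zero (A.homogProj 0 _), ← h.homogProj_zero_generator_mul b₂,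
    ← map_add, hb, A.homogProj_of_mem ha]

variable {ω : B.carrier}

theorem covD_generator_mul
    (h : IsHirsch B A φ (fun _ : Fin 1 => 1) (fun _ => t) (fun _ => e))
    (hω : ω ∈ B.grading 1) (x : B.carrier) :
    covD A (φ.toFun ω) (t * φ.toFun x) = φ.toFun (e * x) - t * φ.toFun (covD B ω x) := by
  have hcomm : φ.toFun ω * t = -(t * φ.toFun ω) := by
    simpa using A.gcomm (φ.map_grading hω) (h.t_mem 0)
  rw [covD_apply, covD_apply, A.leibniz (h.t_mem 0), ← mul_assoc, hcomm, h.dt 0]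
  simp only [map_mul, map_add, φ.map_d, mul_add, ← mul_assoc]
  simp
  abel

theorem covD_coeffs
    (h : IsHirsch B A φ (fun _ : Fin 1 => 1) (fun _ => t) (fun _ => e))
    (hω : ω ∈ B.grading 1) (b₁ b₂ : B.carrier) :
    covD A (φ.toFun ω) (φ.toFun b₁ + t * φ.toFun b₂) =
      φ.toFun (covD B ω b₁ + e * b₂) + t * φ.toFun (-covD B ω b₂) := by
  rw [map_add, covD_map, h.covD_generator_mul hω, map_add, map_neg, mul_neg]
  abel

theorem covD_coeffs_eq_zero_iff
    (h : IsHirsch B A φ (fun _ : Fin 1 => 1) (fun _ => t) (fun _ => e))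
    (hω : ω ∈ B.grading 1) (b₁ b₂ : B.carrier) :
    covD A (φ.toFun ω) (φ.toFun b₁ + t * φ.toFun b₂) = 0 ↔
      covD B ω b₁ + e * b₂ = 0 ∧ covD B ω b₂ = 0 := by
  rw [h.covD_coeffs hω]
  constructor
  · intro hz
    have := h.coeffs_unique (c₁ := 0) (c₂ := 0) (hz.trans (by simp))
    exact ⟨this.1, neg_eq_zero.1 this.2⟩
  · rintro ⟨h₁, h₂⟩
    simp [h₁, h₂]

theorem map_mem_ZcOm_iff
    (h : IsHirsch B A φ (fun _ : Fin 1 => 1) (fun _ => t) (fun _ => e))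
    {i : ℕ} {x : B.carrier} (hx : x ∈ B.grading i) :
    φ.toFun x ∈ ZcOm A (φ.toFun ω) i ↔ x ∈ ZcOm B ω i := by
  have : covD A (φ.toFun ω) (φ.toFun x) = 0 ↔ covD B ω x = 0 := by
    rw [covD_map, map_eq_zero_iff _ h.inj]
  exact ⟨fun hz => ⟨hx, this.1 hz.2⟩, fun hz => ⟨φ.map_grading hx, this.2 hz.2⟩⟩

theorem map_mem_BcOm (φ : CDGAHom B A) {i : ℕ} {x : B.carrier} (hx : x ∈ BcOm B ω i) :
    φ.toFun x ∈ BcOm A (φ.toFun ω) i := by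
  cases i with
  | zero =>
    obtain rfl : x = 0 := hx
    simp
  | succ i =>
    obtain ⟨c, hc, rfl⟩ := hx
    exact ⟨_, φ.map_grading hc, covD_map φ ω c⟩

/-- The map on `d_ω`-cohomology induced by the inclusion `B → B ⊗ Λ(t)`. -/
def inclusionCoh (h : IsHirsch B A φ (fun _ : Fin 1 => 1) (fun _ => t) (fun _ => e))
    (ω : B.carrier) (i : ℕ) : cohOm B ω i →ₗ[k] cohOm A (φ.toFun ω) i :=
  cohOmMap φ.toFun.toLinearMap (fun _ hx => (h.map_mem_ZcOm_iff hx.1).2 hx)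
    fun _ _ hx => map_mem_BcOm φ hx

theorem inclusionCoh_mk
    (h : IsHirsch B A φ (fun _ : Fin 1 => 1) (fun _ => t) (fun _ => e)) {i : ℕ}
    (x : ZcOm B ω i) :
    h.inclusionCoh ω i (Submodule.Quotient.mk x) =
      Submodule.Quotient.mk ⟨φ.toFun x, (h.map_mem_ZcOm_iff x.2.1).2 x.2⟩ := rfl

theorem exists_coeffs_of_mem_ZcOm
    (h : IsHirsch B A φ (fun _ : Fin 1 => 1) (fun _ => t) (fun _ => e))
    (hω : ω ∈ B.grading 1) {i : ℕ} {y : A.carrier} (hy : y ∈ ZcOm A (φ.toFun ω) (i + 1)) :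
    ∃ b₁ ∈ B.grading (i + 1), ∃ b₂ ∈ ZcOm B ω i,
      y = φ.toFun b₁ + t * φ.toFun b₂ ∧ covD B ω b₁ + e * b₂ = 0 := by
  obtain ⟨b₁, hb₁, b₂, hb₂, rfl⟩ := h.exists_coeffs_of_mem_succ hy.1
  obtain ⟨h₁, h₂⟩ := (h.covD_coeffs_eq_zero_iff hω b₁ b₂).1 hy.2
  exact ⟨b₁, hb₁, b₂, ⟨hb₂, h₂⟩, rfl, h₁⟩

theorem generatorCoeff_mem_ZcOm
    (h : IsHirsch B A φ (fun _ : Fin 1 => 1) (fun _ => t) (fun _ => e))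
    (hω : ω ∈ B.grading 1) {i : ℕ} {y : A.carrier} (hy : y ∈ ZcOm A (φ.toFun ω) (i + 1)) :
    h.generatorCoeff y ∈ ZcOm B ω i := by
  obtain ⟨b₁, -, b₂, hb₂, rfl, -⟩ := h.exists_coeffs_of_mem_ZcOm hω hy
  rwa [h.generatorCoeff_apply]

theorem generatorCoeff_mem_BcOm
    (h : IsHirsch B A φ (fun _ : Fin 1 => 1) (fun _ => t) (fun _ => e))
    (hω : ω ∈ B.grading 1) {i : ℕ} {y : A.carrier} (hy : y ∈ BcOm A (φ.toFun ω) (i + 1)) :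
    h.generatorCoeff y ∈ BcOm B ω i := by
  obtain ⟨a, ha, rfl⟩ := hy
  cases i with
  | zero =>
    obtain ⟨b, -, rfl⟩ := h.exists_coeff_of_mem_zero ha
    have : h.generatorCoeff (covD A (φ.toFun ω) (φ.toFun b)) = 0 := by
      rw [covD_map]
      simpa using h.generatorCoeff_apply (covD B ω b) 0
    rw [this]
    exact zero_mem _
  | succ i =>
    obtain ⟨b₁, -, b₂, hb₂, rfl⟩ := h.exists_coeffs_of_mem_succ ha
    rw [h.covD_coeffs hω, h.generatorCoeff_apply]
    exact neg_mem ⟨b₂, hb₂, rfl⟩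

/-- The map on `d_ω`-cohomology induced by the projection onto the coefficient of `t`. -/
def generatorCoeffCoh
    (h : IsHirsch B A φ (fun _ : Fin 1 => 1) (fun _ => t) (fun _ => e))
    (hω : ω ∈ B.grading 1) (i : ℕ) : cohOm A (φ.toFun ω) (i + 1) →ₗ[k] cohOm B ω i :=
  cohOmMap h.generatorCoeff (fun _ hy => h.generatorCoeff_mem_ZcOm hω hy)
    fun _ _ hy => h.generatorCoeff_mem_BcOm hω hy

theorem generatorCoeffCoh_mk
    (h : IsHirsch B A φ (fun _ : Fin 1 => 1) (fun _ => t) (fun _ => e))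
    (hω : ω ∈ B.grading 1) {i : ℕ} (y : ZcOm A (φ.toFun ω) (i + 1)) (x : ZcOm B ω i)
    (b₁ : B.carrier) (hy : (y : A.carrier) = φ.toFun b₁ + t * φ.toFun x) :
    h.generatorCoeffCoh hω i (Submodule.Quotient.mk y) = Submodule.Quotient.mk x := by
  refine (cohOmMap_mk _ _ _ _).trans (congrArg _ (Subtype.ext ?_))
  change h.generatorCoeff y = x
  rw [hy, h.generatorCoeff_apply]

end IsHirsch

theorem cocycle_mul_mem {B : CDGA k} {e : B.carrier} (he : e ∈ B.Zc 2) {i : ℕ} {x : B.carrier}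
    (hx : x ∈ B.grading i) : e * x ∈ B.grading (i + 2) :=
  add_comm 2 i ▸ B.mul_mem he.1 hx

theorem cocycle_mul_mem_ZcOm {B : CDGA k} {e ω : B.carrier} (hω : ω ∈ B.Zc 1) (he : e ∈ B.Zc 2)
    {i : ℕ} {x : B.carrier} (hx : x ∈ ZcOm B ω i) : e * x ∈ ZcOm B ω (i + 2) := by
  refine ⟨cocycle_mul_mem he hx.1, ?_⟩
  have hx₂ : covD B ω x = 0 := hx.2
  change covD B ω (e * x) = 0
  rw [covD_cocycle_mul hω he, hx₂, mul_zero]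

theorem cocycle_mul_mem_BcOm {B : CDGA k} {e ω : B.carrier} (hω : ω ∈ B.Zc 1) (he : e ∈ B.Zc 2)
    {i : ℕ} {x : B.carrier} (hx : x ∈ BcOm B ω i) : e * x ∈ BcOm B ω (i + 2) := by
  cases i with
  | zero =>
    obtain rfl : x = 0 := hx
    simp
  | succ i =>
    obtain ⟨c, hc, rfl⟩ := hx
    exact ⟨e * c, cocycle_mul_mem he hc, covD_cocycle_mul hω he c⟩

/-- Multiplication by a cocycle of degree two on `d_ω`-cohomology. -/
def cocycleMulCoh {B : CDGA k} {e ω : B.carrier} (hω : ω ∈ B.Zc 1) (he : e ∈ B.Zc 2) (i : ℕ) :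
    cohOm B ω i →ₗ[k] cohOm B ω (i + 2) :=
  cohOmMap (LinearMap.mulLeft k e) (fun _ hx => cocycle_mul_mem_ZcOm hω he hx)
    fun _ _ hx => cocycle_mul_mem_BcOm hω he hx

theorem cocycleMulCoh_mk {B : CDGA k} {e ω : B.carrier} (hω : ω ∈ B.Zc 1) (he : e ∈ B.Zc 2)
    {i : ℕ} (x : ZcOm B ω i) :
    cocycleMulCoh hω he i (Submodule.Quotient.mk x) =
      Submodule.Quotient.mk ⟨e * x, cocycle_mul_mem_ZcOm hω he x.2⟩ := rfl

namespace IsHirsch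

variable {B A : CDGA k} {φ : CDGAHom B A} {t : A.carrier} {e ω : B.carrier}

theorem exact_cocycleMulCoh_inclusionCoh
    (h : IsHirsch B A φ (fun _ : Fin 1 => 1) (fun _ => t) (fun _ => e))
    (hω : ω ∈ B.Zc 1) (he : e ∈ B.Zc 2) (i : ℕ) :
    Function.Exact (cocycleMulCoh hω he i) (h.inclusionCoh ω (i + 2)) := by
  intro c
  obtain ⟨x, rfl⟩ := Submodule.Quotient.mk_surjective _ c
  rw [inclusionCoh_mk, cohOm_mk_eq_zero]
  constructor
  · rintro ⟨a, ha, hax : covD A (φ.toFun ω) a = φ.toFun x⟩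
    obtain ⟨c, hc, z, hz, rfl⟩ := h.exists_coeffs_of_mem_succ ha
    rw [h.covD_coeffs hω.1] at hax
    obtain ⟨h₁, h₂⟩ := h.coeffs_unique (c₁ := x) (c₂ := 0) (hax.trans (by simp))
    refine ⟨Submodule.Quotient.mk ⟨z, hz, neg_eq_zero.1 h₂⟩, ?_⟩
    rw [cocycleMulCoh_mk, cohOm_mk_eq]
    refine ⟨-c, neg_mem hc, ?_⟩
    simp [← h₁]
  · rintro ⟨c, hc⟩
    obtain ⟨z, rfl⟩ := Submodule.Quotient.mk_surjective _ c
    rw [cocycleMulCoh_mk, cohOm_mk_eq] at hc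
    have hz : covD B ω z = 0 := z.2.2
    have hez : φ.toFun (e * z) ∈ BcOm A (φ.toFun ω) (i + 2) :=
      ⟨t * φ.toFun z, h.generator_mul_mem z.2.1, by simp [h.covD_generator_mul hω.1, hz]⟩
    have := sub_mem hez (map_mem_BcOm φ hc)
    rw [← map_sub] at this
    simpa using this

theorem exact_inclusionCoh_generatorCoeffCoh
    (h : IsHirsch B A φ (fun _ : Fin 1 => 1) (fun _ => t) (fun _ => e))
    (hω : ω ∈ B.Zc 1) (i : ℕ) :
    Function.Exact (h.inclusionCoh ω (i + 1)) (h.generatorCoeffCoh hω.1 i) := by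
  have he : e ∈ B.Zc 2 := h.e_cocycle 0
  intro c
  obtain ⟨⟨y, hy⟩, rfl⟩ := Submodule.Quotient.mk_surjective _ c
  obtain ⟨b₁, hb₁, b₂, hb₂, rfl, hb⟩ := h.exists_coeffs_of_mem_ZcOm hω.1 hy
  rw [h.generatorCoeffCoh_mk hω.1 _ ⟨b₂, hb₂⟩ b₁ rfl, cohOm_mk_eq_zero]
  constructor
  · intro hB
    suffices ∃ c ∈ ZcOm B ω (i + 1), φ.toFun c - (φ.toFun b₁ + t * φ.toFun b₂) ∈
        BcOm A (φ.toFun ω) (i + 1) by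
      obtain ⟨c, hc, hcB⟩ := this
      exact ⟨Submodule.Quotient.mk ⟨c, hc⟩, (cohOm_mk_eq _ _).2 hcB⟩
    cases i with
    | zero =>
      obtain rfl : b₂ = 0 := hB
      exact ⟨b₁, ⟨hb₁, by simpa using hb⟩, by simp⟩
    | succ i =>
      obtain ⟨z, hz, rfl⟩ := hB
      refine ⟨b₁ + e * z, ⟨add_mem hb₁ (cocycle_mul_mem he hz), ?_⟩,
        t * φ.toFun z, h.generator_mul_mem hz, ?_⟩
      · change covD B ω (b₁ + e * z) = 0
        rw [map_add, covD_cocycle_mul hω he, hb]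
      · rw [h.covD_generator_mul hω.1, map_add]
        abel
  · rintro ⟨c, hc⟩
    obtain ⟨x, rfl⟩ := Submodule.Quotient.mk_surjective _ c
    rw [inclusionCoh_mk, cohOm_mk_eq] at hc
    have hq := h.generatorCoeff_mem_BcOm hω.1 hc
    have : φ.toFun x - (φ.toFun b₁ + t * φ.toFun b₂) =
        φ.toFun (x - b₁) + t * φ.toFun (-b₂) := by
      rw [map_sub, map_neg, mul_neg]
      abel
    change h.generatorCoeff (φ.toFun x - (φ.toFun b₁ + t * φ.toFun b₂)) ∈ _ at hq
    rw [this, h.generatorCoeff_apply] at hq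
    exact neg_mem_iff.1 hq

theorem exact_generatorCoeffCoh_cocycleMulCoh
    (h : IsHirsch B A φ (fun _ : Fin 1 => 1) (fun _ => t) (fun _ => e))
    (hω : ω ∈ B.Zc 1) (he : e ∈ B.Zc 2) (i : ℕ) :
    Function.Exact (h.generatorCoeffCoh hω.1 i) (cocycleMulCoh hω he i) := by
  intro c
  obtain ⟨x, rfl⟩ := Submodule.Quotient.mk_surjective _ c
  have hx : covD B ω x = 0 := x.2.2
  constructor
  · intro hc
    rw [cocycleMulCoh_mk, cohOm_mk_eq_zero] at hc
    obtain ⟨b, hb, hbx : covD B ω b = e * x⟩ := hc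
    refine ⟨Submodule.Quotient.mk ⟨φ.toFun (-b) + t * φ.toFun x,
      add_mem (φ.map_grading (neg_mem hb)) (h.generator_mul_mem x.2.1), ?_⟩,
      h.generatorCoeffCoh_mk hω.1 _ x (-b) rfl⟩
    exact (h.covD_coeffs_eq_zero_iff hω.1 _ _).2 ⟨by simp [hbx], hx⟩
  · rintro ⟨c, hc⟩
    obtain ⟨⟨y, hy⟩, rfl⟩ := Submodule.Quotient.mk_surjective _ c
    obtain ⟨b₁, hb₁, b₂, hb₂, rfl, hb⟩ := h.exists_coeffs_of_mem_ZcOm hω.1 hy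
    rw [h.generatorCoeffCoh_mk hω.1 _ ⟨b₂, hb₂⟩ b₁ rfl] at hc
    rw [← hc, cocycleMulCoh_mk, cohOm_mk_eq_zero]
    refine ⟨-b₁, neg_mem hb₁, ?_⟩
    rw [map_neg]
    exact (eq_neg_of_add_eq_zero_right hb).symm

theorem inclusionCoh_injective_of_reflects
    (h : IsHirsch B A φ (fun _ : Fin 1 => 1) (fun _ => t) (fun _ => e)) {i : ℕ}
    (hB : ∀ x, φ.toFun x ∈ BcOm A (φ.toFun ω) i → x ∈ BcOm B ω i) :
    Function.Injective (h.inclusionCoh ω i) := by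
  rw [← LinearMap.ker_eq_bot, LinearMap.ker_eq_bot']
  intro c hc
  obtain ⟨x, rfl⟩ := Submodule.Quotient.mk_surjective _ c
  rw [inclusionCoh_mk, cohOm_mk_eq_zero] at hc
  exact (cohOm_mk_eq_zero x).2 (hB x hc)

theorem inclusionCoh_zero_injective
    (h : IsHirsch B A φ (fun _ : Fin 1 => 1) (fun _ => t) (fun _ => e)) (ω : B.carrier) :
    Function.Injective (h.inclusionCoh ω 0) :=
  h.inclusionCoh_injective_of_reflects fun _ hx => (map_eq_zero_iff φ.toFun h.inj).1 hx

theorem inclusionCoh_one_injective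
    (h : IsHirsch B A φ (fun _ : Fin 1 => 1) (fun _ => t) (fun _ => e)) (ω : B.carrier) :
    Function.Injective (h.inclusionCoh ω 1) := by
  refine h.inclusionCoh_injective_of_reflects ?_
  rintro x ⟨a, ha, hax⟩
  obtain ⟨b, hb, rfl⟩ := h.exists_coeff_of_mem_zero ha
  rw [covD_map] at hax
  exact ⟨b, hb, h.inj hax⟩

theorem inclusionCoh_zero_surjective
    (h : IsHirsch B A φ (fun _ : Fin 1 => 1) (fun _ => t) (fun _ => e)) (ω : B.carrier) :
    Function.Surjective (h.inclusionCoh ω 0) := by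
  intro c
  obtain ⟨⟨y, hy⟩, rfl⟩ := Submodule.Quotient.mk_surjective _ c
  obtain ⟨b, hb, rfl⟩ := h.exists_coeff_of_mem_zero hy.1
  exact ⟨Submodule.Quotient.mk ⟨b, (h.map_mem_ZcOm_iff hb).1 hy⟩, rfl⟩

theorem quotMap_bijective
    (h : IsHirsch B A φ (fun _ : Fin 1 => 1) (fun _ => t) (fun _ => e)) :
    Function.Bijective (quotMap B A φ t) := by
  constructor
  · rw [← LinearMap.ker_eq_bot, LinearMap.ker_eq_bot']
    intro x hx
    obtain ⟨b, hb : φ.toFun b = t * φ.toFun x⟩ := (Submodule.Quotient.mk_eq_zero _).1 hx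
    exact (h.coeffs_unique (b₁ := 0) (c₁ := b) (c₂ := 0) (by simp [hb])).2
  · intro c
    obtain ⟨a, rfl⟩ := Submodule.Quotient.mk_surjective _ c
    obtain ⟨⟨b₁, b₂⟩, rfl⟩ := h.ofCoeffs_bijective.2 a
    refine ⟨b₂, (Submodule.Quotient.eq _).2 ⟨-b₁, ?_⟩⟩
    simp [ofCoeffs]

end IsHirsch

/-- Let `B` be a connected CDGA, `e ∈ Z²(B)`, `A = B ⊗_e Λ(t)` the Hirsch
extension with one degree-one generator `t` and `dt = e`, and `ω ∈ Z¹(B) ⊆ Z¹(A)`.  Then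
`(B, d_ω)` is a subcomplex of `(A, d_ω)` via the canonical inclusion `φ`, the quotient complex
is isomorphic to the shifted complex `(B^{•-1}, -d_ω)` via `class of t·b ↦ b`, and there is a
long exact sequence
`⋯ → H^{i-2}(B,d_ω) → H^i(B,d_ω) → H^i(A,d_ω) → H^{i-1}(B,d_ω) → H^{i+1}(B,d_ω) → ⋯`. -/
theorem statement9 (B A : CDGA k) (hBconn : B.Connected)
    (φ : CDGAHom B A) (t : A.carrier) (e : B.carrier)
    (hhir : IsHirsch B A φ (fun _ : Fin 1 => 1) (fun _ => t) (fun _ => e))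
    (ω : B.carrier) (hω : ω ∈ B.Zc 1) :
    -- (B, d_ω) is a subcomplex of (A, d_ω) via φ:
    (∀ x : B.carrier, covD A (φ.toFun ω) (φ.toFun x) = φ.toFun (covD B ω x)) ∧
    -- the map b ↦ [t·φ(b)] identifies (B^{•-1}, -d_ω) with the quotient complex A/B:
    Function.Bijective (quotMap B A φ t) ∧
    (∀ x : B.carrier,
      covD A (φ.toFun ω) (t * φ.toFun x) + t * φ.toFun (covD B ω x) ∈
        LinearMap.range φ.toFun.toLinearMap) ∧
    -- the resulting long exact sequence in d_ω-cohomology: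
    (∃ (u : ∀ i : ℕ, cohOm B ω i →ₗ[k] cohOm B ω (i + 2))
       (v : ∀ i : ℕ, cohOm B ω i →ₗ[k] cohOm A (φ.toFun ω) i)
       (w : ∀ i : ℕ, cohOm A (φ.toFun ω) (i + 1) →ₗ[k] cohOm B ω i),
      -- v is induced by φ:
      (∀ (i : ℕ) (x : ↥(ZcOm B ω i)) (hx : φ.toFun ↑x ∈ ZcOm A (φ.toFun ω) i),
        v i (Submodule.Quotient.mk x) =
          Submodule.Quotient.mk (⟨φ.toFun ↑x, hx⟩ : ↥(ZcOm A (φ.toFun ω) i))) ∧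
      -- w is induced by the projection onto the coefficient of t:
      (∀ (i : ℕ) (y : ↥(ZcOm A (φ.toFun ω) (i + 1))) (x : ↥(ZcOm B ω i)) (b₁ : B.carrier),
        (y : A.carrier) = φ.toFun b₁ + t * φ.toFun ↑x →
          w i (Submodule.Quotient.mk y) = Submodule.Quotient.mk x) ∧
      -- exactness:
      (∀ i : ℕ, Function.Exact (u i) (v (i + 2))) ∧
      (∀ i : ℕ, Function.Exact (v (i + 1)) (w i)) ∧
      (∀ i : ℕ, Function.Exact (w i) (u i)) ∧
      Function.Injective (v 0) ∧ Function.Injective (v 1) ∧ Function.Surjective (v 0)) := by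
  have he : e ∈ B.Zc 2 := hhir.e_cocycle 0
  refine ⟨covD_map φ ω, hhir.quotMap_bijective, fun x => ⟨e * x, ?_⟩,
    cocycleMulCoh hω he, hhir.inclusionCoh ω, hhir.generatorCoeffCoh hω.1,
    fun _ _ _ => rfl, fun _ y x b₁ hy => hhir.generatorCoeffCoh_mk hω.1 y x b₁ hy,
    hhir.exact_cocycleMulCoh_inclusionCoh hω he, hhir.exact_inclusionCoh_generatorCoeffCoh hω,
    hhir.exact_generatorCoeffCoh_cocycleMulCoh hω he, hhir.inclusionCoh_zero_injective ω,
    hhir.inclusionCoh_one_injective ω, hhir.inclusionCoh_zero_surjective ω⟩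
  rw [hhir.covD_generator_mul hω.1, sub_add_cancel]
  rfl

end Statement9
end
end
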